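/- Transference: Let k ≥ 2, let i ∈ [k] be fixed, and let P be an order-hereditary, i-monotone property of k-colourings of complete graphs with P_n ≠ ∅ for every n, such that P = Forb(F) for some nonempty collection F of k-colourings of K_N with N ≥ 2. Let p = p(n) ∈ (0,1] satisfy p(n)·n^{1/(2·C(N,2)−1)} → ∞, and let T be a random template distributed as T_{n,p}(i). Then for every fixed ε > 0, with probability tending to 1 as n → ∞, p·(ex(n,P) − ε·n²) ≤ ex(T, P) ≤ p·(ex(n,P) + 2ε·n²). -/

import Mathlib

open Filter

abbrev Edge (n : ℕ) := {p : Fin n × Fin n // p.1 < p.2}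

abbrev Colouring (k n : ℕ) := Edge n → Fin k

abbrev Template (k n : ℕ) := Edge n → Finset (Fin k)

def Proper {k n : ℕ} (t : Template k n) : Prop := ∀ e, (t e).Nonempty

def Realises {k n : ℕ} (c : Colouring k n) (t : Template k n) : Prop := ∀ e, c e ∈ t e

noncomputable def Ent {k n : ℕ} (t : Template k n) : ℝ :=
  ∑ e : Edge n, Real.logb k ((t e).card)

def Edge.map {m n : ℕ} (φ : Fin m → Fin n) (h : StrictMono φ) (e : Edge m) : Edge n :=
  ⟨(φ e.1.1, φ e.1.2), h e.2⟩

def restrictC {k m n : ℕ} (c : Colouring k n) (φ : Fin m → Fin n) (h : StrictMono φ) :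
    Colouring k m := fun e => c (Edge.map φ h e)

def restrictT {k m n : ℕ} (t : Template k n) (φ : Fin m → Fin n) (h : StrictMono φ) :
    Template k m := fun e => t (Edge.map φ h e)

def Forb {k N : ℕ} (F : Set (Colouring k N)) (n : ℕ) : Set (Colouring k n) :=
  {c | ∀ (φ : Fin N → Fin n) (h : StrictMono φ), restrictC c φ h ∉ F}

def OrderHereditary {k : ℕ} (P : ∀ n, Set (Colouring k n)) : Prop :=
  ∀ (m n : ℕ) (φ : Fin m → Fin n) (h : StrictMono φ) (c : Colouring k n),
    c ∈ P n → restrictC c φ h ∈ P m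

noncomputable def exEnt {k n : ℕ} (A : Set (Colouring k n)) : ℝ :=
  sSup {x | ∃ t : Template k n, Proper t ∧ (∀ c, Realises c t → c ∈ A) ∧ Ent t = x}

noncomputable def badPairs {k N n : ℕ} (t : Template k n) (F : Set (Colouring k N)) : ℕ :=
  Set.ncard {p : (Fin N → Fin n) × Colouring k N |
    ∃ h : StrictMono p.1, p.2 ∈ F ∧ Realises p.2 (restrictT t p.1 h)}

def TemplateLE {k m n : ℕ} (t : Template k m) (t' : Template k n) : Prop :=
  ∃ (φ : Fin m → Fin n) (h : StrictMono φ), ∀ e, t e ⊆ restrictT t' φ h e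

def IsContainerFamily {k n : ℕ} (T : Finset (Template k n)) (A : Set (Colouring k n)) : Prop :=
  ∀ t : Template k n, Proper t → (∀ c, Realises c t → c ∈ A) → ∃ t' ∈ T, TemplateLE t t'

/-- The probability weight of a template under the `p`-random template `T_{n,p}(i)`:
each edge independently receives the full palette `[k]` with probability `p` and the
singleton palette `{i}` with probability `1 - p`. -/
noncomputable def templateWeight {k n : ℕ} (p : ℝ) (i : Fin k) (t : Template k n) : ℝ :=
  ∏ e : Edge n,
    (if t e = (Finset.univ : Finset (Fin k)) then p else if t e = {i} then 1 - p else 0)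

/-- The probability that the `p`-random template `T_{n,p}(i)` lies in the set `A`. -/
noncomputable def templateProb {k n : ℕ} (p : ℝ) (i : Fin k) (A : Set (Template k n)) : ℝ :=
  ∑ t : Template k n, Set.indicator A (templateWeight p i) t

/-- `P` is monotone with respect to colour `i`. -/
def IMonotone {k : ℕ} (i : Fin k) (P : ∀ n, Set (Colouring k n)) : Prop :=
  ∀ (n : ℕ) (c : Colouring k n) (e : Edge n), c ∈ P n → Function.update c e i ∈ P n

/-- The extremal entropy of `A` relative to the template `t`. -/
noncomputable def exEntRel {k n : ℕ} (t : Template k n) (A : Set (Colouring k n)) : ℝ :=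
  sSup {x | ∃ t' : Template k n, Proper t' ∧ (∀ e, t' e ⊆ t e) ∧
    (∀ c, Realises c t' → c ∈ A) ∧ Ent t' = x}


def Cov {V : Type} [DecidableEq V] (W : Finset V) (x : ℝ) (M : ℕ) (Q : Finset V → Prop) : Prop :=
  ∃ 𝒞 : Finset (Finset V), 𝒞.card ≤ M ∧ (∀ C ∈ 𝒞, x ≤ ((W \ C).card : ℝ)) ∧
    ∀ I ⊆ W, Q I → ∃ C ∈ 𝒞, I ⊆ C

lemma Cov.mono {V : Type} [DecidableEq V] {W : Finset V} {x : ℝ} {M M' : ℕ}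
    {Q Q' : Finset V → Prop} (h : Cov W x M Q) (hM : M ≤ M') (hQ : ∀ I, Q' I → Q I) :
    Cov W x M' Q' := by
  obtain ⟨C, h1, h2, h3⟩ := h
  exact ⟨C, h1.trans hM, h2, fun I hI hq => h3 I hI (hQ I hq)⟩

lemma Cov.union {V : Type} [DecidableEq V] {W : Finset V} {x : ℝ} {M1 M2 M : ℕ}
    {Q1 Q2 Q : Finset V → Prop} (h1 : Cov W x M1 Q1) (h2 : Cov W x M2 Q2) (hM : M1 + M2 ≤ M)
    (hQ : ∀ I, Q I → Q1 I ∨ Q2 I) : Cov W x M Q := by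
  obtain ⟨C, a1, a2, a3⟩ := h1
  obtain ⟨D, b1, b2, b3⟩ := h2
  refine ⟨C ∪ D, (Finset.card_union_le _ _).trans (by omega), ?_, ?_⟩
  · intro X hX
    rcases Finset.mem_union.1 hX with h | h
    · exact a2 X h
    · exact b2 X h
  · intro I hI hq
    rcases hQ I hq with h | h
    · obtain ⟨X, hX, hs⟩ := a3 I hI h
      exact ⟨X, Finset.mem_union_left _ hX, hs⟩
    · obtain ⟨X, hX, hs⟩ := b3 I hI h
      exact ⟨X, Finset.mem_union_right _ hX, hs⟩

lemma sum_deg_eq {ι V : Type} [DecidableEq V] (W : Finset V) (E : Finset ι) (g : ι → Finset V)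
    (hg : ∀ e ∈ E, g e ⊆ W) :
    ∑ v ∈ W, (E.filter (fun e => v ∈ g e)).card = ∑ e ∈ E, (g e).card := by
  have := Finset.sum_card_bipartiteAbove_eq_sum_card_bipartiteBelow (s := W) (t := E)
    (fun v e => v ∈ g e)
  unfold Finset.bipartiteAbove Finset.bipartiteBelow at this
  rw [this]
  refine Finset.sum_congr rfl fun e he => ?_
  congr 1
  ext v
  simp only [Finset.mem_filter]
  exact ⟨fun h => h.2, fun h => ⟨hg e he h, h⟩⟩

lemma card_hit_le {ι V : Type} [DecidableEq ι] [DecidableEq V] (T : Finset V) (E E' : Finset ι)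
    (g : ι → Finset V) (Δ : ℝ)
    (hdeg : ∀ v, ((E.filter (fun e => v ∈ g e)).card : ℝ) ≤ Δ)
    (hE' : E' ⊆ E) (hit : ∀ e ∈ E', ∃ v ∈ T, v ∈ g e) :
    (E'.card : ℝ) ≤ T.card * Δ := by
  have h1 : E' ⊆ T.biUnion (fun v => E.filter (fun e => v ∈ g e)) := by
    intro e he
    obtain ⟨v, hv, hve⟩ := hit e he
    exact Finset.mem_biUnion.2 ⟨v, hv, Finset.mem_filter.2 ⟨hE' he, hve⟩⟩
  have h2 : (E'.card : ℝ) ≤ ∑ v ∈ T, ((E.filter (fun e => v ∈ g e)).card : ℝ) := by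
    exact_mod_cast (Finset.card_le_card h1).trans Finset.card_biUnion_le
  refine h2.trans ?_
  calc _ ≤ ∑ v ∈ T, Δ := Finset.sum_le_sum fun v _ => hdeg v
    _ = T.card * Δ := by simp

lemma inner_process {ι V : Type} [DecidableEq ι] [DecidableEq V] (W : Finset V) (E : Finset ι)
    (g : ι → Finset V) (m Δ B θ δ x : ℝ) (a s M : ℕ) (hm : 0 < m) (hWm : (W.card : ℝ) ≤ m)
    (hΔ : 0 < Δ) (hB : 0 ≤ B) (hθ : 0 < θ) (hδ : 0 < δ) (hM : 1 ≤ M)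
    (hgW : ∀ e ∈ E, g e ⊆ W) (hcard : ∀ e ∈ E, (g e).card = s + 2)
    (hdeg : ∀ v, ((E.filter (fun e => v ∈ g e)).card : ℝ) ≤ Δ)
    (hcod : ∀ u v, u ≠ v → ((E.filter (fun e => u ∈ g e ∧ v ∈ g e)).card : ℝ) ≤ B)
    (hE : δ * m * Δ ≤ E.card) (hxa : x + a ≤ δ / 4 * m)
    (hsat : (s + 1) * a * Δ ≤ δ / 4 * m * θ)
    (hfin : ∀ (E2 : Finset ι) (g2 : ι → Finset V), E2 ⊆ E →
      (∀ e ∈ E2, g2 e ⊆ g e ∧ (g2 e).card = s + 1) →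
      (∀ v, ((E2.filter (fun e => v ∈ g2 e)).card : ℝ) ≤ θ + B) →
      a * (δ / 2 * Δ) ≤ E2.card → Cov W x M (fun I => ∀ e ∈ E2, ¬ g2 e ⊆ I)) :
    ∀ (l : ℕ) (R S : Finset V) (E2 : Finset ι) (g2 : ι → Finset V), R ⊆ W → S ⊆ W →
      (W \ (R ∪ S)).card ≤ l → S.card ≤ a → E2 ⊆ E →
      (∀ e ∈ E2, g2 e ⊆ g e ∧ (g2 e).card = s + 1 ∧ g e ⊆ g2 e ∪ S) →
      (∀ v, ((E2.filter (fun e => v ∈ g2 e)).card : ℝ) ≤ θ + B) →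
      S.card * (δ / 2 * Δ) ≤ E2.card →
      Cov W x ((l + 1) ^ (a - S.card) * M)
        (fun I => (∀ e ∈ E, ¬ g e ⊆ I) ∧ S ⊆ I ∧ Disjoint R I) := by
  intro l
  induction l with
  | zero => ?_
  | succ l ih => ?_
  all_goals
    intro R S E2 g2 hR hS hl hSa hE2 hg2 hdeg2 hE2c
    by_cases hSeq : S.card = a
    · refine (hfin E2 g2 hE2 (fun e he => ⟨(hg2 e he).1, (hg2 e he).2.1⟩) hdeg2
        (by rw [← hSeq]; exact hE2c)).mono ?_ ?_
      · rw [hSeq]; simp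
      · rintro I ⟨h1, h2, -⟩ e he hsub
        exact h1 e (hE2 he) ((hg2 e he).2.2.trans (Finset.union_subset hsub h2))
    by_cases hRx : x ≤ R.card
    · refine ⟨{W \ R}, ?_, ?_, ?_⟩
      · rw [Finset.card_singleton]
        exact Nat.one_le_iff_ne_zero.2 (Nat.mul_ne_zero (by positivity) (by omega))
      · intro C hC
        rw [Finset.mem_singleton.1 hC, Finset.sdiff_sdiff_eq_self hR]
        exact hRx
      · rintro I hI ⟨-, -, h3⟩
        exact ⟨_, Finset.mem_singleton_self _, fun v hv => Finset.mem_sdiff.2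
          ⟨hI hv, fun hvR => Finset.disjoint_left.1 h3 hvR hv⟩⟩
    push Not at hRx
    set A := (W \ (R ∪ S)).filter
      (fun w => ((E2.filter (fun e => w ∈ g2 e)).card : ℝ) ≤ θ) with hA
    set E1 := E.filter (fun e => g e ⊆ A) with hE1
    have hAW : A ⊆ W := (Finset.filter_subset _ _).trans Finset.sdiff_subset
    have hsatc : ((W.filter (fun w => θ < ((E2.filter (fun e => w ∈ g2 e)).card : ℝ))).card : ℝ)
        ≤ δ / 4 * m := by
      have h1 : ((W.filter (fun w => θ < ((E2.filter (fun e => w ∈ g2 e)).card : ℝ))).card : ℝ) * θ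
          ≤ ∑ w ∈ W, ((E2.filter (fun e => w ∈ g2 e)).card : ℝ) := by
        rw [← nsmul_eq_mul, ← Finset.sum_const]
        refine (Finset.sum_le_sum (fun w hw => (Finset.mem_filter.1 hw).2.le)).trans ?_
        exact Finset.sum_le_sum_of_subset_of_nonneg (Finset.filter_subset _ _)
          (fun _ _ _ => Nat.cast_nonneg _)
      have h2 : ∑ w ∈ W, ((E2.filter (fun e => w ∈ g2 e)).card : ℝ) = (s + 1) * E2.card := by
        have := sum_deg_eq W E2 g2 (fun e he => (hg2 e he).1.trans (hgW e (hE2 he)))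
        rw [Finset.sum_congr rfl (fun e he => (hg2 e he).2.1)] at this
        rw [← Nat.cast_sum, this]
        simp [mul_comm]
      have h3 : (E2.card : ℝ) ≤ S.card * Δ := by
        refine card_hit_le S E E2 g Δ hdeg hE2 fun e he => ?_
        by_contra hcon
        push Not at hcon
        obtain ⟨-, q2, q3⟩ := hg2 e he
        have : g e ⊆ g2 e := fun v hv => by
          rcases Finset.mem_union.1 (q3 hv) with h | h
          · exact h
          · exact absurd hv (hcon v h)
        have := Finset.card_le_card this
        rw [q2, hcard e (hE2 he)] at this
        omega
      have h4 : (S.card : ℝ) ≤ a := by exact_mod_cast hSa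
      have h5 : ((s : ℝ) + 1) * E2.card ≤ (s + 1) * a * Δ := by
        rw [mul_assoc]
        exact mul_le_mul_of_nonneg_left
          (h3.trans (mul_le_mul_of_nonneg_right h4 hΔ.le)) (by positivity)
      have h6 := (h1.trans_eq h2).trans (h5.trans hsat)
      exact le_of_mul_le_mul_right h6 hθ
    have hWA : ((W \ A).card : ℝ) ≤ δ / 2 * m := by
      have h1 : W \ A ⊆ R ∪ S ∪
          W.filter (fun w => θ < ((E2.filter (fun e => w ∈ g2 e)).card : ℝ)) := by
        intro w hw
        rw [Finset.mem_sdiff] at hw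
        simp only [hA, Finset.mem_filter, Finset.mem_sdiff, Finset.mem_union] at hw ⊢
        by_cases h : θ < ((E2.filter (fun e => w ∈ g2 e)).card : ℝ)
        · exact Or.inr ⟨hw.1, h⟩
        · left
          by_contra hc
          exact hw.2 ⟨⟨hw.1, hc⟩, not_lt.1 h⟩
      have h2 := (Finset.card_le_card h1).trans ((Finset.card_union_le _ _).trans
        (Nat.add_le_add_right (Finset.card_union_le _ _) _))
      have h3 : ((W \ A).card : ℝ) ≤ R.card + S.card +
        (W.filter (fun w => θ < ((E2.filter (fun e => w ∈ g2 e)).card : ℝ))).card := by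
        exact_mod_cast h2
      have h4 : (S.card : ℝ) ≤ a := by exact_mod_cast hSa
      linarith
    have hE1c : δ / 2 * m * Δ ≤ E1.card := by
      have h1 := card_hit_le (W \ A) E (E \ E1) g Δ hdeg Finset.sdiff_subset (by
        intro e he
        simp only [hE1, Finset.mem_sdiff, Finset.mem_filter, not_and] at he
        obtain ⟨v, hv, hv'⟩ := Finset.not_subset.1 (he.2 he.1)
        exact ⟨v, Finset.mem_sdiff.2 ⟨hgW e he.1 hv, hv'⟩, hv⟩)
      have h2 : (E.card : ℝ) = (E \ E1).card + E1.card := by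
        exact_mod_cast (Finset.card_sdiff_add_card_eq_card (Finset.filter_subset _ E)).symm
      have h3 := mul_le_mul_of_nonneg_right hWA hΔ.le
      linarith
    have hv : ∃ v ∈ A, δ / 2 * Δ ≤ ((E1.filter (fun e => v ∈ g e)).card : ℝ) := by
      by_contra hcon
      push Not at hcon
      have h1 : ∑ v ∈ A, ((E1.filter (fun e => v ∈ g e)).card : ℝ) = (s + 2) * E1.card := by
        have := sum_deg_eq A E1 g (fun e he => (Finset.mem_filter.1 he).2)
        rw [Finset.sum_congr rfl (fun e he => hcard e (Finset.mem_filter.1 he).1)] at this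
        rw [← Nat.cast_sum, this]
        simp [mul_comm, hE1]
      have hpos : 0 < δ / 2 * m * Δ := by positivity
      rcases A.eq_empty_or_nonempty with h0 | h0
      · rw [h0, Finset.sum_empty] at h1
        have : 0 < ((s : ℝ) + 2) * E1.card := mul_pos (by positivity) (hpos.trans_le hE1c)
        linarith
      · have h2 := Finset.sum_lt_sum_of_nonempty h0 hcon
        rw [h1, Finset.sum_const, nsmul_eq_mul] at h2
        have h3 : (A.card : ℝ) ≤ m := le_trans (by exact_mod_cast Finset.card_le_card hAW) hWm
        have h4 := mul_le_mul_of_nonneg_right h3 (by positivity : 0 ≤ δ / 2 * Δ)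
        have h5 : (E1.card : ℝ) ≤ (s + 2) * E1.card := by
          have : (0:ℝ) ≤ (s + 1) * E1.card := by positivity
          linarith
        linarith
    obtain ⟨v, hvA, hvd⟩ := hv
    have hvW : v ∈ W \ (R ∪ S) := (Finset.mem_filter.1 hvA).1
    have hvW' := Finset.mem_sdiff.1 hvW
    have hvR : v ∉ R := fun h => hvW'.2 (Finset.mem_union_left _ h)
    have hvS : v ∉ S := fun h => hvW'.2 (Finset.mem_union_right _ h)
  · exact absurd (Finset.card_pos.2 ⟨v, hvW⟩) (by omega)
  · have hdec : (W \ (insert v (R ∪ S))).card ≤ l := by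
      have : W \ (insert v (R ∪ S)) = (W \ (R ∪ S)).erase v := by
        ext w; simp only [Finset.mem_sdiff, Finset.mem_insert, Finset.mem_erase]; tauto
      rw [this, Finset.card_erase_of_mem hvW]
      omega
    have b1 := ih (insert v R) S E2 g2 (Finset.insert_subset hvW'.1 hR) hS
      (by rw [Finset.insert_union]; exact hdec) hSa hE2 hg2 hdeg2 hE2c
    set Nw := E1.filter (fun e => v ∈ g e) with hNw
    have hNE1 : ∀ e ∈ Nw, e ∈ E ∧ g e ⊆ A ∧ v ∈ g e := by
      intro e he
      have h1 := Finset.mem_filter.1 he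
      have h2 := Finset.mem_filter.1 h1.1
      exact ⟨h2.1, h2.2, h1.2⟩
    have hdisj : Disjoint E2 Nw := by
      rw [Finset.disjoint_left]
      intro e he he'
      obtain ⟨q1, q2, q3⟩ := hg2 e he
      obtain ⟨r1, r2, r3⟩ := hNE1 e he'
      have : g e ⊆ g2 e := fun u hu => by
        rcases Finset.mem_union.1 (q3 hu) with h | h
        · exact h
        · have := (Finset.mem_sdiff.1 (Finset.mem_filter.1 (r2 hu)).1).2
          exact absurd (Finset.mem_union_right _ h) this
      have := Finset.card_le_card this
      rw [q2, hcard e r1] at this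
      omega
    have b2 := ih R (insert v S) (E2 ∪ Nw) (fun e => if e ∈ E2 then g2 e else (g e).erase v) hR
      (Finset.insert_subset hvW'.1 hS) (by rw [Finset.union_insert]; exact hdec)
      (by rw [Finset.card_insert_of_notMem hvS]; omega)
      (Finset.union_subset hE2 (fun e he => (hNE1 e he).1))
      (by
        intro e he
        by_cases h : e ∈ E2
        · simp only [h, if_true]
          exact ⟨(hg2 e h).1, (hg2 e h).2.1, (hg2 e h).2.2.trans
            (Finset.union_subset_union_right (Finset.subset_insert _ _))⟩
        · simp only [h, if_false]
          obtain ⟨r1, r2, r3⟩ := hNE1 e ((Finset.mem_union.1 he).resolve_left h)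
          refine ⟨Finset.erase_subset _ _, ?_, ?_⟩
          · rw [Finset.card_erase_of_mem r3, hcard e r1]; omega
          · intro u hu
            by_cases huv : u = v
            · exact Finset.mem_union_right _ (by rw [huv]; exact Finset.mem_insert_self _ _)
            · exact Finset.mem_union_left _ (Finset.mem_erase.2 ⟨huv, hu⟩))
      (by
        intro w
        have h1 : (E2 ∪ Nw).filter
            (fun e => w ∈ (if e ∈ E2 then g2 e else (g e).erase v)) ⊆
            E2.filter (fun e => w ∈ g2 e) ∪ Nw.filter (fun e => w ∈ (g e).erase v) := by
          intro e he
          obtain ⟨h1, h2⟩ := Finset.mem_filter.1 he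
          by_cases h : e ∈ E2
          · simp only [h, if_true] at h2
            exact Finset.mem_union_left _ (Finset.mem_filter.2 ⟨h, h2⟩)
          · simp only [h, if_false] at h2
            exact Finset.mem_union_right _
              (Finset.mem_filter.2 ⟨(Finset.mem_union.1 h1).resolve_left h, h2⟩)
        have h2 : (((E2 ∪ Nw).filter
            (fun e => w ∈ (if e ∈ E2 then g2 e else (g e).erase v))).card : ℝ) ≤
            (E2.filter (fun e => w ∈ g2 e)).card +
              (Nw.filter (fun e => w ∈ (g e).erase v)).card := by
          exact_mod_cast (Finset.card_le_card h1).trans (Finset.card_union_le _ _)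
        rcases (Nw.filter (fun e => w ∈ (g e).erase v)).eq_empty_or_nonempty with h0 | ⟨e, he⟩
        · rw [h0] at h2
          simp only [Finset.card_empty, Nat.cast_zero, add_zero] at h2
          exact h2.trans (hdeg2 w)
        · obtain ⟨he1, he2⟩ := Finset.mem_filter.1 he
          obtain ⟨hwv, hwe⟩ := Finset.mem_erase.1 he2
          have hwA := (hNE1 e he1).2.1 hwe
          have h3 := (Finset.mem_filter.1 hwA).2
          have h4 : ((Nw.filter (fun e => w ∈ (g e).erase v)).card : ℝ) ≤ B := by
            refine le_trans ?_ (hcod w v hwv)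
            norm_cast
            refine Finset.card_le_card fun e he => ?_
            obtain ⟨h5, h6⟩ := Finset.mem_filter.1 he
            exact Finset.mem_filter.2 ⟨(hNE1 e h5).1, (Finset.mem_erase.1 h6).2,
              (hNE1 e h5).2.2⟩
          linarith)
      (by
        rw [Finset.card_insert_of_notMem hvS, Finset.card_union_of_disjoint hdisj]
        push_cast
        linarith)
    refine b1.union b2 ?_ ?_
    · rw [Finset.card_insert_of_notMem hvS]
      obtain ⟨b, hb⟩ : ∃ b, a - S.card = b + 1 := ⟨a - S.card - 1, by omega⟩
      have hb' : a - (S.card + 1) = b := by omega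
      rw [hb, hb', ← add_mul]
      refine Nat.mul_le_mul_right _ ?_
      have : (l + 1) ^ b ≤ (l + 1 + 1) ^ b := Nat.pow_le_pow_left (by omega) b
      calc (l + 1) ^ (b + 1) + (l + 1) ^ b = (l + 1) ^ b * (l + 1 + 1) := by ring
        _ ≤ (l + 1 + 1) ^ b * (l + 1 + 1) := Nat.mul_le_mul_right _ this
        _ = _ := by ring
    · rintro I ⟨h1, h2, h3⟩
      by_cases hvI : v ∈ I
      · exact Or.inr ⟨h1, Finset.insert_subset hvI h2, h3⟩
      · exact Or.inl ⟨h1, h2, Finset.disjoint_insert_left.2 ⟨hvI, h3⟩⟩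

lemma container_level (s : ℕ) : ∀ δ : ℝ, 0 < δ → ∃ γ : ℝ, 0 < γ ∧ ∃ κ : ℝ, 0 < κ ∧
    ∀ {ι V : Type} [DecidableEq ι] [DecidableEq V] (W : Finset V) (E : Finset ι)
    (g : ι → Finset V) (m Δ B : ℝ) (a : ℕ), 0 < m → (W.card : ℝ) ≤ m → 0 < Δ → 0 ≤ B →
    (∀ e ∈ E, g e ⊆ W) → (∀ e ∈ E, (g e).card = s + 1) →
    (∀ v, ((E.filter (fun e => v ∈ g e)).card : ℝ) ≤ Δ) →
    (∀ u v, u ≠ v → ((E.filter (fun e => u ∈ g e ∧ v ∈ g e)).card : ℝ) ≤ B) →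
    δ * m * Δ ≤ E.card → B ≤ κ * (a / m) ^ s * Δ → (a : ℝ) ≤ γ * m → 1 ≤ a →
    Cov W (γ * m) ((W.card + 1) ^ (a * s)) (fun I => ∀ e ∈ E, ¬ g e ⊆ I) := by
  induction s with
  | zero =>
    intro δ hδ
    refine ⟨δ, hδ, 1, one_pos, ?_⟩
    intro ι V _ _ W E g m Δ B a hm hWm hΔ hB hgW hcard hdeg hcod hE hBk ha ha1
    refine ⟨{W \ E.biUnion g}, by simp, ?_, ?_⟩
    · intro C hC
      rw [Finset.mem_singleton.1 hC, Finset.sdiff_sdiff_eq_self (Finset.biUnion_subset.2 hgW)]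
      have h1 := card_hit_le (E.biUnion g) E E g Δ hdeg (Finset.Subset.refl _) (by
        intro e he
        obtain ⟨v, hv⟩ := Finset.card_pos.1 (by rw [hcard e he]; omega : 0 < (g e).card)
        exact ⟨v, Finset.mem_biUnion.2 ⟨e, he, hv⟩, hv⟩)
      exact le_of_mul_le_mul_right (hE.trans h1) hΔ
    · intro I hI hind
      refine ⟨_, Finset.mem_singleton_self _, fun v hv => Finset.mem_sdiff.2 ⟨hI hv, ?_⟩⟩
      intro hv'
      obtain ⟨e, he, hve⟩ := Finset.mem_biUnion.1 hv'
      refine hind e he ?_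
      obtain ⟨u, hu⟩ := Finset.card_eq_one.1 (hcard e he)
      rw [hu] at hve ⊢
      rw [Finset.mem_singleton.1 hve] at hv
      exact Finset.singleton_subset_iff.2 hv
  | succ s ih =>
    intro δ hδ
    set K : ℝ := 4 * (s + 1) / δ with hK
    have hK0 : 0 < K := by positivity
    obtain ⟨γ', hγ', κ', hκ', hrec⟩ := ih (δ / (4 * K)) (by positivity)
    refine ⟨min γ' (min (δ / 8) 1), by positivity, min K (2 * K * κ'), by positivity, ?_⟩
    intro ι V _ _ W E g m Δ B a hm hWm hΔ hB hgW hcard hdeg hcod hE hBk ha ha1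
    set γ := min γ' (min (δ / 8) 1) with hγ
    have hγ1 : γ ≤ γ' := min_le_left _ _
    have hγ2 : γ ≤ δ / 8 := (min_le_right _ _).trans (min_le_left _ _)
    have hγ3 : γ ≤ 1 := (min_le_right _ _).trans (min_le_right _ _)
    have ha0 : (0 : ℝ) < a := by exact_mod_cast ha1
    set τ : ℝ := a / m with hτ
    have hτ0 : 0 < τ := by positivity
    have hτ1 : τ ≤ 1 := by
      rw [hτ, div_le_one hm]
      exact ha.trans (mul_le_of_le_one_left hm.le hγ3)
    have haτ : (a : ℝ) = τ * m := by rw [hτ]; field_simp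
    have hBθ : B ≤ K * τ * Δ := by
      refine hBk.trans (mul_le_mul_of_nonneg_right ?_ hΔ.le)
      refine mul_le_mul (min_le_left _ _) ?_ (by positivity) hK0.le
      rw [pow_succ]
      exact mul_le_of_le_one_left hτ0.le (pow_le_one₀ hτ0.le hτ1)
    have key := inner_process W E g m Δ B (K * τ * Δ) δ (γ * m) a s ((W.card + 1) ^ (a * s))
      hm hWm hΔ hB (by positivity) hδ (Nat.one_le_pow _ _ (by omega)) hgW hcard hdeg hcod hE
      (by
        have := mul_le_mul_of_nonneg_right hγ2 hm.le
        linarith)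
      (by
        rw [haτ, hK]
        apply le_of_eq
        field_simp)
      (by
        intro E2 g2 hE2 hg2 hdeg2 hc
        have := hrec W E2 g2 m (2 * (K * τ * Δ)) B a hm hWm (by positivity) hB
          (fun e he => (hg2 e he).1.trans (hgW e (hE2 he))) (fun e he => (hg2 e he).2)
          (fun v => (hdeg2 v).trans (by linarith))
          (fun u v huv => le_trans (by
            norm_cast
            refine Finset.card_le_card fun e he => ?_
            obtain ⟨h1, h2, h3⟩ := Finset.mem_filter.1 he
            exact Finset.mem_filter.2 ⟨hE2 h1, (hg2 e h1).1 h2, (hg2 e h1).1 h3⟩) (hcod u v huv))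
          (by
            refine le_trans (le_of_eq ?_) hc
            rw [haτ]
            field_simp
            norm_num)
          (by
            refine hBk.trans ?_
            calc _ ≤ 2 * K * κ' * τ ^ (s + 1) * Δ := by
                  gcongr
                  exact min_le_right _ _
              _ = _ := by rw [← hτ]; ring)
          (ha.trans (by gcongr)) ha1
        obtain ⟨C, c1, c2, c3⟩ := this
        exact ⟨C, c1, fun X hX => le_trans (by gcongr) (c2 X hX), c3⟩)
      W.card ∅ ∅ ∅ (fun _ => ∅) (by simp) (by simp) (by simp) (by simp) (by simp) (by simp)
      (by intro v; simp; positivity) (by simp)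
    refine key.mono ?_ ?_
    · rw [Finset.card_empty, Nat.sub_zero, ← pow_add]
      exact le_of_eq (by ring)
    · intro I hI
      exact ⟨hI, by simp, by simp⟩

abbrev HIdx (k N n : ℕ) := {φ : Fin N → Fin n // StrictMono φ} × Colouring k N

def gset {k N n : ℕ} (x : HIdx k N n) : Finset (Edge n × Fin k) :=
  Finset.univ.image (fun e : Edge N => (Edge.map x.1.1 x.1.2 e, x.2 e))

lemma edge_map_inj {m n : ℕ} (φ : Fin m → Fin n) (h : StrictMono φ) :
    Function.Injective (Edge.map φ h) := by
  rintro ⟨⟨a, b⟩, hab⟩ ⟨⟨c, d⟩, hcd⟩ heq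
  simp only [Edge.map, Subtype.mk.injEq, Prod.mk.injEq] at heq ⊢
  exact ⟨h.injective heq.1, h.injective heq.2⟩

lemma card_edge (n : ℕ) : Fintype.card (Edge n) = n.choose 2 := by
  rw [Fintype.card_subtype]
  have h1 : (Finset.univ.filter (fun p : Fin n × Fin n => p.1 < p.2)).card
      = ∑ j : Fin n, (j : ℕ) := by
    rw [Finset.card_filter, Fintype.sum_prod_type_right]
    refine Finset.sum_congr rfl fun j _ => ?_
    rw [← Finset.card_filter]
    rw [← Fin.card_Iio j]
    congr 1
    ext x
    simp
  rw [h1, Fin.sum_univ_eq_sum_range (fun j => j), Finset.sum_range_id, Nat.choose_two_right]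

lemma gset_card {k N n : ℕ} (x : HIdx k N n) : (gset x).card = N.choose 2 := by
  unfold gset
  rw [Finset.card_image_of_injective, Finset.card_univ, card_edge]
  intro a b hab
  exact edge_map_inj _ x.1.2 (Prod.mk.inj hab).1

lemma pin {N n : ℕ} (Φ : Finset (Fin N → Fin n)) (X : Finset (Fin N))
    (hΦ : ∀ φ ∈ Φ, ∀ ψ ∈ Φ, ∀ x ∈ X, φ x = ψ x) : Φ.card * n ^ X.card ≤ n ^ N := by
  classical
  rcases Φ.eq_empty_or_nonempty with h | ⟨φ₀, h0⟩
  · simp [h]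
  have h1 : Φ ⊆ Fintype.piFinset (fun x => if x ∈ X then {φ₀ x} else Finset.univ) := by
    intro φ hφ
    rw [Fintype.mem_piFinset]
    intro x
    by_cases hx : x ∈ X
    · simp [hx, hΦ φ hφ φ₀ h0 x hx]
    · simp [hx]
  refine (Nat.mul_le_mul_right _ (Finset.card_le_card h1)).trans (le_of_eq ?_)
  rw [Fintype.card_piFinset]
  have h2 : ∀ x : Fin N, (if x ∈ X then ({φ₀ x} : Finset (Fin n)) else Finset.univ).card
      = if x ∈ X then 1 else n := by
    intro x; split_ifs <;> simp
  rw [Finset.prod_congr rfl (fun x _ => h2 x)]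
  have h3 : n ^ X.card = ∏ x : Fin N, if x ∈ X then n else 1 := by
    rw [Finset.prod_ite_mem]; simp
  rw [h3, ← Finset.prod_mul_distrib]
  have h4 : ∀ x : Fin N, (if x ∈ X then 1 else n) * (if x ∈ X then n else 1) = n := by
    intro x; split_ifs <;> simp
  rw [Finset.prod_congr rfl (fun x _ => h4 x)]
  simp

lemma pin' {k N n : ℕ} (Y : Finset (HIdx k N n)) (X : Finset (Fin N)) (d : ℕ) (hn : 1 ≤ n)
    (hd : d ≤ X.card)
    (hY : ∀ y ∈ Y, ∀ z ∈ Y, ∀ x ∈ X, y.1.1 x = z.1.1 x) :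
    Y.card * n ^ d ≤ n ^ N * k ^ (N.choose 2) := by
  classical
  have h1 : Y.card ≤ ((Y.image (fun y => y.1.1)) ×ˢ (Finset.univ : Finset (Colouring k N))).card := by
    refine Finset.card_le_card_of_injOn (fun y => (y.1.1, y.2)) ?_ ?_
    · intro y hy
      simp only [Finset.coe_product, Set.mem_prod]
      exact ⟨Finset.mem_image_of_mem _ hy, by simp⟩
    · rintro ⟨⟨a, ha⟩, b⟩ _ ⟨⟨c, hc⟩, d⟩ _ hab
      simp only [Prod.mk.injEq] at hab
      obtain ⟨rfl, rfl⟩ := hab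
      rfl
  have h2 : Fintype.card (Colouring k N) = k ^ (N.choose 2) := by
    rw [Fintype.card_fun, card_edge, Fintype.card_fin]
  rw [Finset.card_product, Finset.card_univ, h2] at h1
  have h3 := pin (Y.image (fun y => y.1.1)) X (by
    intro φ hφ ψ hψ x hx
    obtain ⟨y, hy, rfl⟩ := Finset.mem_image.1 hφ
    obtain ⟨z, hz, rfl⟩ := Finset.mem_image.1 hψ
    exact hY y hy z hz x hx)
  calc Y.card * n ^ d ≤ ((Y.image (fun y => y.1.1)).card * k ^ (N.choose 2)) * n ^ X.card :=
        Nat.mul_le_mul h1 (Nat.pow_le_pow_right hn hd)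
    _ = ((Y.image (fun y => y.1.1)).card * n ^ X.card) * k ^ (N.choose 2) := by ring
    _ ≤ _ := Nat.mul_le_mul_right _ h3

lemma mem_gset {k N n : ℕ} (x : HIdx k N n) (v : Edge n × Fin k) :
    v ∈ gset x ↔ ∃ e, Edge.map x.1.1 x.1.2 e = v.1 ∧ x.2 e = v.2 := by
  unfold gset
  simp only [Finset.mem_image, Finset.mem_univ, true_and]
  constructor
  · rintro ⟨e, rfl⟩; exact ⟨e, rfl, rfl⟩
  · rintro ⟨e, h1, h2⟩; exact ⟨e, Prod.ext h1 h2⟩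

lemma deg_bound {k N n : ℕ} (hn : 1 ≤ n) (E : Finset (HIdx k N n)) (v : Edge n × Fin k) :
    (E.filter (fun x => v ∈ gset x)).card * n ^ 2
      ≤ N.choose 2 * (n ^ N * k ^ (N.choose 2)) := by
  classical
  have h1 : E.filter (fun x => v ∈ gset x) ⊆ (Finset.univ : Finset (Edge N)).biUnion
      (fun e => E.filter (fun x => Edge.map x.1.1 x.1.2 e = v.1)) := by
    intro x hx
    obtain ⟨hx1, hx2⟩ := Finset.mem_filter.1 hx
    obtain ⟨e, he, -⟩ := (mem_gset x v).1 hx2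
    exact Finset.mem_biUnion.2 ⟨e, Finset.mem_univ _, Finset.mem_filter.2 ⟨hx1, he⟩⟩
  have h2 := (Finset.card_le_card h1).trans Finset.card_biUnion_le
  refine (Nat.mul_le_mul_right _ h2).trans ?_
  rw [Finset.sum_mul]
  have h3 : ∀ e ∈ (Finset.univ : Finset (Edge N)),
      (E.filter (fun x => Edge.map x.1.1 x.1.2 e = v.1)).card * n ^ 2
        ≤ n ^ N * k ^ (N.choose 2) := by
    intro e _
    refine pin' _ {e.1.1, e.1.2} 2 hn ?_ ?_
    · rw [Finset.card_pair (ne_of_lt e.2)]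
    · intro y hy z hz x hx
      have hy' := (Finset.mem_filter.1 hy).2
      have hz' := (Finset.mem_filter.1 hz).2
      rw [← hz'] at hy'
      simp only [Edge.map, Subtype.mk.injEq, Prod.mk.injEq] at hy'
      rcases Finset.mem_insert.1 hx with rfl | hx
      · exact hy'.1
      · rw [Finset.mem_singleton.1 hx]; exact hy'.2
  refine (Finset.sum_le_sum h3).trans ?_
  rw [Finset.sum_const, Finset.card_univ, card_edge, smul_eq_mul]

lemma three_le {N : ℕ} (e e' : Edge N) (h : e ≠ e') :
    3 ≤ ({e.1.1, e.1.2, e'.1.1, e'.1.2} : Finset (Fin N)).card := by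
  obtain ⟨⟨a, b⟩, hab⟩ := e
  obtain ⟨⟨c, d⟩, hcd⟩ := e'
  simp only at hab hcd ⊢
  simp only [ne_eq, Subtype.mk.injEq, Prod.mk.injEq, not_and] at h
  have key : ∀ x y z : Fin N, x ≠ y → x ≠ z → y ≠ z →
      ({x, y, z} : Finset (Fin N)) ⊆ {a, b, c, d} → 3 ≤ ({a, b, c, d} : Finset (Fin N)).card := by
    intro x y z h1 h2 h3 hs
    rw [← Finset.card_eq_three.2 ⟨x, y, z, h1, h2, h3, rfl⟩]
    exact Finset.card_le_card hs
  by_cases h1 : a = c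
  · have h2 := h h1
    refine key a b d hab.ne ?_ h2 ?_
    · rw [h1]; exact hcd.ne
    · intro x; simp only [Finset.mem_insert, Finset.mem_singleton]; tauto
  · by_cases h3 : b = c
    · refine key a b d hab.ne ?_ ?_ ?_
      · rw [← h3] at hcd; exact (hab.trans hcd).ne
      · rw [h3]; exact hcd.ne
      · intro x; simp only [Finset.mem_insert, Finset.mem_singleton]; tauto
    · refine key a b c hab.ne h1 h3 ?_
      intro x; simp only [Finset.mem_insert, Finset.mem_singleton]; tauto

lemma cod_bound {k N n : ℕ} (hn : 1 ≤ n) (E : Finset (HIdx k N n)) (u v : Edge n × Fin k)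
    (huv : u ≠ v) :
    (E.filter (fun x => u ∈ gset x ∧ v ∈ gset x)).card * n ^ 3
      ≤ (N.choose 2 * N.choose 2) * (n ^ N * k ^ (N.choose 2)) := by
  classical
  have h1 : E.filter (fun x => u ∈ gset x ∧ v ∈ gset x) ⊆
      (Finset.univ : Finset (Edge N × Edge N)).biUnion
      (fun e => E.filter (fun x => e.1 ≠ e.2 ∧ Edge.map x.1.1 x.1.2 e.1 = u.1 ∧
        Edge.map x.1.1 x.1.2 e.2 = v.1)) := by
    intro x hx
    obtain ⟨hx1, hx2, hx3⟩ := Finset.mem_filter.1 hx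
    obtain ⟨e, he, hec⟩ := (mem_gset x u).1 hx2
    obtain ⟨e', he', hec'⟩ := (mem_gset x v).1 hx3
    refine Finset.mem_biUnion.2 ⟨(e, e'), Finset.mem_univ _,
      Finset.mem_filter.2 ⟨hx1, ?_, he, he'⟩⟩
    intro hee
    simp only at hee
    subst hee
    exact huv (Prod.ext (he.symm.trans he') (hec.symm.trans hec'))
  have h2 := (Finset.card_le_card h1).trans Finset.card_biUnion_le
  refine (Nat.mul_le_mul_right _ h2).trans ?_
  rw [Finset.sum_mul]
  have h3 : ∀ e ∈ (Finset.univ : Finset (Edge N × Edge N)),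
      (E.filter (fun x => e.1 ≠ e.2 ∧ Edge.map x.1.1 x.1.2 e.1 = u.1 ∧
        Edge.map x.1.1 x.1.2 e.2 = v.1)).card * n ^ 3
        ≤ n ^ N * k ^ (N.choose 2) := by
    rintro ⟨e, e'⟩ _
    by_cases hee : e = e'
    · simp [hee]
    refine pin' _ {e.1.1, e.1.2, e'.1.1, e'.1.2} 3 hn (three_le e e' hee) ?_
    intro y hy z hz x hx
    obtain ⟨-, -, hy1, hy2⟩ := Finset.mem_filter.1 hy
    obtain ⟨-, -, hz1, hz2⟩ := Finset.mem_filter.1 hz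
    rw [← hz1] at hy1
    rw [← hz2] at hy2
    simp only [Edge.map, Subtype.mk.injEq, Prod.mk.injEq] at hy1 hy2
    simp only [Finset.mem_insert, Finset.mem_singleton] at hx
    rcases hx with rfl | rfl | rfl | rfl
    · exact hy1.1
    · exact hy1.2
    · exact hy2.1
    · exact hy2.2
  refine (Finset.sum_le_sum h3).trans ?_
  rw [Finset.sum_const, Finset.card_univ, Fintype.card_prod, card_edge, smul_eq_mul]

lemma card_verts_le (k n : ℕ) (W : Finset (Edge n × Fin k)) : W.card ≤ k * n ^ 2 := by
  refine (Finset.card_le_univ _).trans ?_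
  rw [Fintype.card_prod, Fintype.card_fin, mul_comm]
  refine Nat.mul_le_mul_left _ ?_
  refine (Fintype.card_subtype_le _).trans ?_
  simp [sq]

lemma container_family (k N : ℕ) (hk : 1 ≤ k) (hN : 2 ≤ N) (δ₀ : ℝ) (hδ₀ : 0 < δ₀) :
    ∃ J : ℕ, ∃ γ : ℝ, 0 < γ ∧ ∃ κ : ℝ, 0 < κ ∧ ∀ (n a : ℕ) (E : Finset (HIdx k N n)),
      1 ≤ n → 1 ≤ a →
      (N.choose 2 : ℝ) / n ≤ κ * ((a : ℝ) / (k * (n : ℝ) ^ 2)) ^ (N.choose 2 - 1) →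
      (a : ℝ) ≤ γ * (k * (n : ℝ) ^ 2) →
      ∃ 𝒞 : Finset (Finset (Edge n × Fin k)),
        𝒞.card ≤ ((k * n ^ 2 + 1) ^ (a * (N.choose 2 - 1))) ^ J ∧
        (∀ C ∈ 𝒞, ((E.filter (fun x => gset x ⊆ C)).card : ℝ) < δ₀ * (n : ℝ) ^ N) ∧
        ∀ I, (∀ x ∈ E, ¬ gset x ⊆ I) → ∃ C ∈ 𝒞, I ⊆ C := by
  classical
  have hr : 1 ≤ N.choose 2 := Nat.choose_pos hN
  obtain ⟨s, hs⟩ : ∃ s, N.choose 2 = s + 1 := ⟨N.choose 2 - 1, by omega⟩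
  set r := N.choose 2 with hrdef
  have hk0 : (0 : ℝ) < k := by exact_mod_cast hk
  have hr0 : (0 : ℝ) < r := by exact_mod_cast hr
  obtain ⟨γ, hγ, κ, hκ, hlev⟩ := container_level s (δ₀ / (k * r * (k : ℝ) ^ r)) (by positivity)
  refine ⟨⌈1 / γ⌉₊, γ, hγ, κ, hκ, ?_⟩
  intro n a E hn ha hcond haγ
  have hn0 : (0 : ℝ) < n := by exact_mod_cast hn
  set m : ℝ := k * (n : ℝ) ^ 2 with hm
  have hm0 : 0 < m := by positivity
  set Δ : ℝ := r * ((n : ℝ) ^ N * (k : ℝ) ^ r) / (n : ℝ) ^ 2 with hΔ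
  set B : ℝ := (r * r) * ((n : ℝ) ^ N * (k : ℝ) ^ r) / (n : ℝ) ^ 3 with hB
  have hΔ0 : 0 < Δ := by positivity
  have hB0 : 0 ≤ B := by positivity
  set Q := (k * n ^ 2 + 1) ^ (a * (r - 1)) with hQ
  have hQ1 : 1 ≤ Q := Nat.one_le_pow _ _ (by omega)
  have main : ∀ (j : ℕ) (W : Finset (Edge n × Fin k)), (W.card : ℝ) ≤ j * (γ * m) →
      ∃ 𝒞 : Finset (Finset (Edge n × Fin k)), 𝒞.card ≤ Q ^ j ∧
        (∀ C ∈ 𝒞, ((E.filter (fun x => gset x ⊆ C)).card : ℝ) < δ₀ * (n : ℝ) ^ N) ∧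
        ∀ I ⊆ W, (∀ x ∈ E, ¬ gset x ⊆ I) → ∃ C ∈ 𝒞, I ⊆ C := by
    intro j
    induction j with
    | zero =>
      intro W hW
      have : W = ∅ := by
        rw [← Finset.card_eq_zero]
        have : (W.card : ℝ) ≤ 0 := by simpa using hW
        exact_mod_cast le_antisymm this (Nat.cast_nonneg _)
      subst this
      refine ⟨{∅}, by simp, ?_, ?_⟩
      · intro C hC
        rw [Finset.mem_singleton.1 hC]
        have : E.filter (fun x => gset x ⊆ ∅) = ∅ := by
          rw [Finset.filter_eq_empty_iff]
          intro x _ hx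
          have := gset_card x
          rw [Finset.subset_empty.1 hx, Finset.card_empty] at this
          omega
        rw [this]
        simp
        positivity
      · intro I hI _
        exact ⟨∅, by simp, hI⟩
    | succ j ih =>
      intro W hW
      by_cases hc : ((E.filter (fun x => gset x ⊆ W)).card : ℝ) < δ₀ * (n : ℝ) ^ N
      · exact ⟨{W}, by simpa using Nat.one_le_pow _ _ hQ1,
          fun C hC => by rw [Finset.mem_singleton.1 hC]; exact hc,
          fun I hI _ => ⟨W, by simp, hI⟩⟩
      push Not at hc
      obtain ⟨𝒟, d1, d2, d3⟩ := hlev W (E.filter (fun x => gset x ⊆ W)) gset m Δ B a hm0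
        (by rw [hm]; exact_mod_cast card_verts_le k n W) hΔ0 hB0
        (fun e he => (Finset.mem_filter.1 he).2) (fun e _ => by rw [gset_card]; exact hs)
        (fun v => by
          rw [hΔ, le_div_iff₀ (by positivity)]
          exact_mod_cast deg_bound hn _ v)
        (fun u v huv => by
          rw [hB, le_div_iff₀ (by positivity)]
          exact_mod_cast cod_bound hn _ u v huv)
        (by
          refine le_trans (le_of_eq ?_) hc
          rw [hm, hΔ]
          field_simp)
        (by
          have : B = r / n * Δ := by
            rw [hB, hΔ]; field_simp
          rw [this]
          refine mul_le_mul_of_nonneg_right ?_ hΔ0.le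
          have hs' : r - 1 = s := by omega
          rw [hs'] at hcond
          exact hcond)
        haγ ha
      have hchoose : ∀ C ∈ 𝒟, ∃ 𝒞 : Finset (Finset (Edge n × Fin k)), 𝒞.card ≤ Q ^ j ∧
        (∀ C ∈ 𝒞, ((E.filter (fun x => gset x ⊆ C)).card : ℝ) < δ₀ * (n : ℝ) ^ N) ∧
        ∀ I ⊆ C ∩ W, (∀ x ∈ E, ¬ gset x ⊆ I) → ∃ C ∈ 𝒞, I ⊆ C := by
        intro C hC
        apply ih
        have h1 := d2 C hC
        have h2 : (W.card : ℝ) = (W \ C).card + (C ∩ W).card := by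
          have := Finset.card_sdiff_add_card_inter W C
          rw [Finset.inter_comm C W]
          exact_mod_cast this.symm
        push_cast at hW
        linarith
      choose! f f1 f2 f3 using hchoose
      refine ⟨𝒟.biUnion f, ?_, ?_, ?_⟩
      · refine Finset.card_biUnion_le.trans ((Finset.sum_le_sum f1).trans ?_)
        rw [Finset.sum_const, smul_eq_mul, pow_succ, mul_comm (Q ^ j)]
        refine Nat.mul_le_mul_right _ (d1.trans ?_)
        have hs' : r - 1 = s := by omega
        rw [hQ, hs']
        exact Nat.pow_le_pow_left (Nat.add_le_add_right (card_verts_le k n W) 1) _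
      · intro C hC
        obtain ⟨D, hD, hCD⟩ := Finset.mem_biUnion.1 hC
        exact f2 D hD C hCD
      · intro I hI hind
        obtain ⟨D, hD, hID⟩ := d3 I hI (fun e he => hind e (Finset.mem_filter.1 he).1)
        obtain ⟨C, hC, hIC⟩ := f3 D hD I (Finset.subset_inter hID hI) hind
        exact ⟨C, Finset.mem_biUnion.2 ⟨D, hD, hC⟩, hIC⟩
  obtain ⟨𝒞, c1, c2, c3⟩ := main ⌈1 / γ⌉₊ Finset.univ (by
    have h1 : ((Finset.univ : Finset (Edge n × Fin k)).card : ℝ) ≤ m := by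
      rw [hm]; exact_mod_cast card_verts_le k n _
    refine h1.trans ?_
    have h2 := Nat.le_ceil (1 / γ)
    have h3 := mul_le_mul_of_nonneg_right h2 (by positivity : 0 ≤ γ * m)
    have h4 : 1 / γ * (γ * m) = m := by field_simp
    linarith)
  exact ⟨𝒞, c1, c2, fun I => c3 I (Finset.subset_univ _)⟩

def tOf {k n : ℕ} (C : Finset (Edge n × Fin k)) : Template k n :=
  fun e => Finset.univ.filter (fun c => (e, c) ∈ C)

lemma logw_nonneg {k : ℕ} (hk : 2 ≤ k) (c : ℕ) : 0 ≤ Real.logb k c := by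
  rcases Nat.eq_zero_or_pos c with h | h
  · simp [h]
  · exact Real.logb_nonneg (by exact_mod_cast (by omega : 1 < k)) (by exact_mod_cast h)

lemma logw_mono {k : ℕ} (hk : 2 ≤ k) {c d : ℕ} (hc : 1 ≤ c) (hcd : c ≤ d) :
    Real.logb k c ≤ Real.logb k d := by
  exact Real.logb_le_logb_of_le (by exact_mod_cast (by omega : 1 < k)) (by exact_mod_cast hc)
    (by exact_mod_cast hcd)

lemma logw_le_one {k : ℕ} (hk : 2 ≤ k) (s : Finset (Fin k)) : Real.logb k s.card ≤ 1 := by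
  have hk1 : (1 : ℝ) < k := by exact_mod_cast (by omega : 1 < k)
  rcases Nat.eq_zero_or_pos s.card with h | h
  · simp [h]
  · have := logw_mono hk h (Finset.card_le_univ s)
    rw [Fintype.card_fin, Real.logb_self_eq_one hk1] at this
    exact this

lemma ent_nonneg {k n : ℕ} (hk : 2 ≤ k) (t : Template k n) : 0 ≤ Ent t :=
  Finset.sum_nonneg fun _ _ => logw_nonneg hk _

lemma ent_le {k n : ℕ} (hk : 2 ≤ k) (t : Template k n) : Ent t ≤ n.choose 2 := by
  refine (Finset.sum_le_sum (fun e _ => logw_le_one hk (t e))).trans ?_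
  rw [Finset.sum_const, Finset.card_univ, card_edge]
  simp

lemma exEnt_nonneg {k n : ℕ} (hk : 2 ≤ k) (A : Set (Colouring k n)) : 0 ≤ exEnt A := by
  refine Real.sSup_nonneg ?_
  rintro x ⟨t, -, -, rfl⟩
  exact ent_nonneg hk t

lemma le_exEnt {k n : ℕ} (hk : 2 ≤ k) (A : Set (Colouring k n)) (t : Template k n)
    (ht : Proper t) (h : ∀ c, Realises c t → c ∈ A) : Ent t ≤ exEnt A := by
  refine le_csSup ⟨n.choose 2, ?_⟩ ⟨t, ht, h, rfl⟩
  rintro x ⟨t, -, -, rfl⟩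
  exact ent_le hk t

lemma ent_restrict {k n M : ℕ} (t : Template k n) (S : Finset (Fin n)) (hS : S.card = M) :
    Ent (restrictT t (S.orderEmbOfFin hS) (S.orderEmbOfFin hS).strictMono) =
      ∑ e ∈ (Finset.univ : Finset (Edge n)).filter (fun e => {e.1.1, e.1.2} ⊆ S),
        Real.logb k (t e).card := by
  classical
  have h1 : (Finset.univ : Finset (Edge n)).filter (fun e => {e.1.1, e.1.2} ⊆ S) =
      (Finset.univ : Finset (Edge M)).image
        (Edge.map (S.orderEmbOfFin hS) (S.orderEmbOfFin hS).strictMono) := by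
    ext e
    simp only [Finset.mem_filter, Finset.mem_univ, true_and, Finset.mem_image]
    have hr := Finset.range_orderEmbOfFin S hS
    constructor
    · intro h
      have h1 : e.1.1 ∈ Set.range (S.orderEmbOfFin hS) := by rw [hr]; exact h (by simp)
      have h2 : e.1.2 ∈ Set.range (S.orderEmbOfFin hS) := by rw [hr]; exact h (by simp)
      obtain ⟨a, ha⟩ := h1
      obtain ⟨b, hb⟩ := h2
      refine ⟨⟨(a, b), ?_⟩, ?_⟩
      · have := e.2
        rw [← ha, ← hb] at this
        exact (S.orderEmbOfFin hS).lt_iff_lt.1 this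
      · exact Subtype.ext (Prod.ext ha hb)
    · rintro ⟨e', rfl⟩ x hx
      simp only [Edge.map, Finset.mem_insert, Finset.mem_singleton] at hx
      rcases hx with rfl | rfl <;> exact Finset.orderEmbOfFin_mem _ _ _
  rw [h1, Finset.sum_image (fun a _ b _ h => edge_map_inj _ _ h)]
  rfl

lemma sum_restrict {k n M : ℕ} (hM : 2 ≤ M) (t : Template k n) :
    ∑ S ∈ (Finset.univ : Finset (Fin n)).powersetCard M,
      ∑ e ∈ (Finset.univ : Finset (Edge n)).filter (fun e => {e.1.1, e.1.2} ⊆ S),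
        Real.logb k (t e).card = ((n - 2).choose (M - 2) : ℝ) * Ent t := by
  classical
  simp_rw [Finset.sum_filter]
  rw [Finset.sum_comm]
  unfold Ent
  rw [Finset.mul_sum]
  refine Finset.sum_congr rfl fun e _ => ?_
  rw [← Finset.sum_filter, Finset.sum_const, nsmul_eq_mul]
  congr 2
  have h2 : ({e.1.1, e.1.2} : Finset (Fin n)).card = 2 := Finset.card_pair (ne_of_lt e.2)
  rw [Finset.card_filter_powersetCard_subset _ _ _ (Finset.subset_univ _) (by rw [h2]; exact hM),
    h2, Finset.card_univ, Fintype.card_fin]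

lemma supersat (k N : ℕ) (hk : 2 ≤ k) (hN : 2 ≤ N) (F : Set (Colouring k N)) (ε : ℝ)
    (hε : 0 < ε) : ∃ δ₀ : ℝ, 0 < δ₀ ∧ ∃ n₀ : ℕ, ∀ n ≥ n₀, ∀ (E : Finset (HIdx k N n)),
      (∀ x, x.2 ∈ F → x ∈ E) → ∀ C : Finset (Edge n × Fin k), Proper (tOf C) →
      ((E.filter (fun x => gset x ⊆ C)).card : ℝ) < δ₀ * (n : ℝ) ^ N →
      Ent (tOf C) ≤ exEnt (Forb F n) + ε * (n : ℝ) ^ 2 := by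
  classical
  set X : ℕ → ℝ := fun n => exEnt (Forb F n) / n.choose 2 with hX
  have hX0 : ∀ n, 0 ≤ X n := fun n => div_nonneg (exEnt_nonneg hk _) (Nat.cast_nonneg _)
  obtain ⟨M, hMN, hM⟩ : ∃ M, N ≤ M ∧ ∀ n, N ≤ n → X M ≤ X n + ε := by
    have hbdd : BddBelow (X '' Set.Ici N) := ⟨0, by rintro _ ⟨n, -, rfl⟩; exact hX0 n⟩
    have hne : (X '' Set.Ici N).Nonempty := ⟨X N, N, Set.self_mem_Ici, rfl⟩
    obtain ⟨_, ⟨M, hM, rfl⟩, hlt⟩ := exists_lt_of_csInf_lt hne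
      (lt_add_of_pos_right (sInf (X '' Set.Ici N)) hε)
    refine ⟨M, hM, fun n hn => ?_⟩
    have := csInf_le hbdd ⟨n, hn, rfl⟩
    linarith
  have hM2 : 2 ≤ M := hN.trans hMN
  have hMNc : (0 : ℝ) < M.choose N := by exact_mod_cast Nat.choose_pos hMN
  have hf : (0 : ℝ) < N.factorial := by exact_mod_cast N.factorial_pos
  refine ⟨ε / (M.choose N * N.factorial * 2 ^ N), by positivity, max M (2 * N), ?_⟩
  intro n hn E hE C hC hcount
  have hnM : M ≤ n := (le_max_left _ _).trans hn
  have hnN : 2 * N ≤ n := (le_max_right _ _).trans hn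
  by_contra hcon
  push Not at hcon
  set t := tOf C with ht
  set Eb := E.filter (fun x => gset x ⊆ C) with hEb
  set bad := ((Finset.univ : Finset (Fin n)).powersetCard M).filter
    (fun S => ∃ x ∈ Eb, Finset.univ.image x.1.1 ⊆ S) with hbad
  have hsum : ((n - 2).choose (M - 2) : ℝ) * Ent t ≤
      n.choose M * exEnt (Forb F M) + bad.card * M.choose 2 := by
    rw [← sum_restrict hM2 t]
    have h1 : ∀ S ∈ (Finset.univ : Finset (Fin n)).powersetCard M,
        ∑ e ∈ (Finset.univ : Finset (Edge n)).filter (fun e => {e.1.1, e.1.2} ⊆ S),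
        Real.logb k (t e).card ≤ exEnt (Forb F M) +
          if (∃ x ∈ Eb, Finset.univ.image x.1.1 ⊆ S) then (M.choose 2 : ℝ) else 0 := by
      intro S hS
      have hSc := (Finset.mem_powersetCard.1 hS).2
      rw [← ent_restrict t S hSc]
      split_ifs with hb
      · have := ent_le hk (restrictT t (S.orderEmbOfFin hSc) (S.orderEmbOfFin hSc).strictMono)
        have := exEnt_nonneg hk (Forb F M)
        linarith
      · rw [add_zero]
        refine le_exEnt hk _ _ (fun e => hC _) ?_
        intro c hc ψ hψ hcF
        refine hb ⟨(⟨(S.orderEmbOfFin hSc) ∘ ψ, (S.orderEmbOfFin hSc).strictMono.comp hψ⟩,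
          restrictC c ψ hψ), Finset.mem_filter.2 ⟨hE _ hcF, ?_⟩, ?_⟩
        · intro v hv
          obtain ⟨e, he1, he2⟩ := (mem_gset _ _).1 hv
          have h3 := hc (Edge.map ψ hψ e)
          have h4 := (Finset.mem_filter.1 h3).2
          have h5 : v = (Edge.map (S.orderEmbOfFin hSc) (S.orderEmbOfFin hSc).strictMono
            (Edge.map ψ hψ e), c (Edge.map ψ hψ e)) := by
            refine Prod.ext ?_ ?_
            · rw [← he1]; rfl
            · rw [← he2]; rfl
          rw [h5]
          exact h4
        · intro y hy
          obtain ⟨z, -, rfl⟩ := Finset.mem_image.1 hy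
          exact Finset.orderEmbOfFin_mem _ _ _
    refine (Finset.sum_le_sum h1).trans (le_of_eq ?_)
    rw [Finset.sum_add_distrib, Finset.sum_const, Finset.card_powersetCard, Finset.card_univ,
      Fintype.card_fin, nsmul_eq_mul, ← Finset.sum_filter, Finset.sum_const, nsmul_eq_mul]
  have hbadc : (bad.card : ℝ) ≤ Eb.card * (n - N).choose (M - N) := by
    have h1 : bad ⊆ Eb.biUnion (fun x => ((Finset.univ : Finset (Fin n)).powersetCard M).filter
        (fun S => Finset.univ.image x.1.1 ⊆ S)) := by
      intro S hS
      obtain ⟨h1, x, hx, h2⟩ := Finset.mem_filter.1 hS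
      exact Finset.mem_biUnion.2 ⟨x, hx, Finset.mem_filter.2 ⟨h1, h2⟩⟩
    have h2 := (Finset.card_le_card h1).trans Finset.card_biUnion_le
    have h3 : ∀ x ∈ Eb, (((Finset.univ : Finset (Fin n)).powersetCard M).filter
        (fun S => Finset.univ.image x.1.1 ⊆ S)).card = (n - N).choose (M - N) := by
      intro x _
      have h4 : (Finset.univ.image x.1.1).card = N := by
        rw [Finset.card_image_of_injective _ x.1.2.injective, Finset.card_univ, Fintype.card_fin]
      rw [Finset.card_filter_powersetCard_subset _ _ _ (Finset.subset_univ _)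
        (by rw [h4]; exact hMN), h4, Finset.card_univ, Fintype.card_fin]
    rw [Finset.sum_congr rfl h3, Finset.sum_const, smul_eq_mul] at h2
    exact_mod_cast h2
  have hid2 : (n.choose M : ℝ) * M.choose 2 = n.choose 2 * (n - 2).choose (M - 2) := by
    exact_mod_cast Nat.choose_mul hM2
  have hidN : (n.choose M : ℝ) * M.choose N = n.choose N * (n - N).choose (M - N) := by
    exact_mod_cast Nat.choose_mul hMN
  have hq : (0 : ℝ) < (n - 2).choose (M - 2) := by
    exact_mod_cast Nat.choose_pos (by omega)
  have hq' : (0 : ℝ) < (n - N).choose (M - N) := by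
    exact_mod_cast Nat.choose_pos (by omega)
  have hc2 : (0 : ℝ) < n.choose 2 := by exact_mod_cast Nat.choose_pos (by omega)
  have hcm : (0 : ℝ) < M.choose 2 := by exact_mod_cast Nat.choose_pos (by omega)
  have hexM : exEnt (Forb F M) = X M * M.choose 2 := by
    simp only [hX]; field_simp
  have hexn : exEnt (Forb F n) = X n * n.choose 2 := by
    simp only [hX]; field_simp
  have hXM := hM n (hMN.trans hnM)
  have hn2 : 2 * (n.choose 2 : ℝ) ≤ (n : ℝ) ^ 2 := by
    have : 2 * n.choose 2 ≤ n ^ 2 := by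
      rw [Nat.choose_two_right]
      have := Nat.mul_div_le (n * (n - 1)) 2
      have h3 : n * (n - 1) ≤ n ^ 2 := by rw [sq]; exact Nat.mul_le_mul_left _ (by omega)
      omega
    exact_mod_cast this
  have hb1 : ε * n.choose M ≤ bad.card := by
    refine le_of_mul_le_mul_right ?_ hcm
    have e1 : ((n - 2).choose (M - 2) : ℝ) * (X n * n.choose 2 + 2 * ε * n.choose 2) ≤
        (n - 2).choose (M - 2) * Ent t := by
      refine mul_le_mul_of_nonneg_left ?_ hq.le
      rw [hexn] at hcon
      have := mul_le_mul_of_nonneg_left hn2 hε.le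
      linarith
    have e2 : (n.choose M : ℝ) * exEnt (Forb F M) ≤ (n.choose M * M.choose 2) * (X n + ε) := by
      rw [hexM, mul_comm (X M), ← mul_assoc]
      exact mul_le_mul_of_nonneg_left hXM (by positivity)
    have e3 : ε * (n.choose M : ℝ) * M.choose 2 =
      ε * (n.choose 2 * (n - 2).choose (M - 2)) := by rw [mul_assoc, hid2]
    rw [hid2] at e2
    rw [e3]
    linarith
  have hb2 : ε * n.choose N ≤ Eb.card * M.choose N := by
    refine le_of_mul_le_mul_right ?_ hq'
    calc ε * n.choose N * (n - N).choose (M - N) = ε * n.choose M * M.choose N := by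
          rw [mul_assoc, ← hidN]; ring
      _ ≤ bad.card * M.choose N := mul_le_mul_of_nonneg_right hb1 hMNc.le
      _ ≤ Eb.card * (n - N).choose (M - N) * M.choose N :=
          mul_le_mul_of_nonneg_right hbadc hMNc.le
      _ = _ := by ring
  have hnc : (n : ℝ) ^ N / (N.factorial * 2 ^ N) ≤ n.choose N := by
    have h1 := Nat.pow_le_choose (α := ℝ) N n
    refine le_trans ?_ h1
    have h2 : (n : ℝ) / 2 ≤ ((n + 1 - N : ℕ) : ℝ) := by
      rw [div_le_iff₀ two_pos]
      exact_mod_cast (by omega : n ≤ (n + 1 - N) * 2)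
    have h3 := pow_le_pow_left₀ (by positivity) h2 N
    rw [div_pow] at h3
    calc (n : ℝ) ^ N / (N.factorial * 2 ^ N) = (n : ℝ) ^ N / 2 ^ N / N.factorial := by
          field_simp
      _ ≤ _ := div_le_div_of_nonneg_right h3 hf.le
  have h1 := mul_le_mul_of_nonneg_left hnc hε.le
  have h2 := h1.trans hb2
  have h3 : ε / (M.choose N * N.factorial * 2 ^ N) * (n : ℝ) ^ N * M.choose N =
      ε * ((n : ℝ) ^ N / (N.factorial * 2 ^ N)) := by field_simp
  have h4 := mul_lt_mul_of_pos_right hcount hMNc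
  linarith

lemma univ_ne_single {k : ℕ} (hk : 2 ≤ k) (i : Fin k) :
    (Finset.univ : Finset (Fin k)) ≠ {i} := by
  intro h
  have := congrArg Finset.card h
  rw [Finset.card_univ, Fintype.card_fin, Finset.card_singleton] at this
  omega

lemma weight_sum {k n : ℕ} (hk : 2 ≤ k) (p : ℝ) (i : Fin k)
    (h : Edge n → Finset (Fin k) → ℝ) :
    ∑ t : Template k n, templateWeight p i t * ∏ e, h e (t e) =
      ∏ e, (p * h e Finset.univ + (1 - p) * h e {i}) := by
  classical
  have hne := univ_ne_single hk i
  have h1 : ∀ e : Edge n, p * h e Finset.univ + (1 - p) * h e {i} =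
      ∑ s : Finset (Fin k), (if s = (Finset.univ : Finset (Fin k)) then p
        else if s = {i} then 1 - p else 0) * h e s := by
    intro e
    have h2 : ∀ s : Finset (Fin k), (if s = (Finset.univ : Finset (Fin k)) then p
        else if s = {i} then 1 - p else 0) * h e s =
        (if s = (Finset.univ : Finset (Fin k)) then p * h e s else 0) +
        (if s = {i} then (1 - p) * h e s else 0) := by
      intro s
      by_cases hs : s = Finset.univ
      · subst hs; simp [hne]
      · simp [hs]
    rw [Finset.sum_congr rfl (fun s _ => h2 s), Finset.sum_add_distrib, Finset.sum_ite_eq',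
      Finset.sum_ite_eq']
    simp
  rw [Finset.prod_congr rfl (fun e _ => h1 e), Fintype.prod_sum]
  refine Finset.sum_congr rfl fun t _ => ?_
  unfold templateWeight
  rw [← Finset.prod_mul_distrib]

lemma weight_nonneg {k n : ℕ} {p : ℝ} (hp : p ∈ Set.Ioc (0 : ℝ) 1) (i : Fin k)
    (t : Template k n) : 0 ≤ templateWeight p i t := by
  refine Finset.prod_nonneg fun e _ => ?_
  split_ifs
  · exact hp.1.le
  · linarith [hp.2]
  · exact le_rfl

lemma weight_supp {k n : ℕ} {p : ℝ} (i : Fin k) (t : Template k n)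
    (h : templateWeight p i t ≠ 0) : ∀ e, t e = Finset.univ ∨ t e = {i} := by
  intro e
  have := Finset.prod_ne_zero_iff.1 h e (Finset.mem_univ e)
  by_contra hc
  push Not at hc
  simp [hc.1, hc.2] at this

lemma weight_total {k n : ℕ} (hk : 2 ≤ k) (p : ℝ) (i : Fin k) :
    ∑ t : Template k n, templateWeight p i t = 1 := by
  have := weight_sum (n := n) hk p i (fun _ _ => 1)
  simpa using this

lemma card_edge_le (n : ℕ) : (Fintype.card (Edge n) : ℝ) ≤ (n : ℝ) ^ 2 := by
  have : Fintype.card (Edge n) ≤ n ^ 2 := by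
    refine (Fintype.card_subtype_le _).trans ?_
    simp [sq]
  exact_mod_cast this

def devSet {k n : ℕ} (p ε : ℝ) (w : Edge n → ℝ) : Set (Template k n) :=
  {T | p * ∑ e, w e + p * ε * (n : ℝ) ^ 2 < ∑ e, if T e = Finset.univ then w e else 0}

lemma dev_bound {k n : ℕ} (hk : 2 ≤ k) {p : ℝ} (hp : p ∈ Set.Ioc (0 : ℝ) 1) (i : Fin k)
    {ε : ℝ} (hε : 0 < ε) (w : Edge n → ℝ) (hw : ∀ e, |w e| ≤ 1) :
    templateProb p i (devSet (k := k) p ε w) ≤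
      Real.exp (-(min 1 (ε / 2) * ε / 2) * (p * (n : ℝ) ^ 2)) := by
  classical
  set l := min 1 (ε / 2) with hl
  have hl0 : 0 < l := by positivity
  have hl1 : l ≤ 1 := min_le_left _ _
  have hl2 : l ≤ ε / 2 := min_le_right _ _
  set y := p * ∑ e, w e + p * ε * (n : ℝ) ^ 2 with hy
  have h1 : templateProb p i (devSet (k := k) p ε w) ≤
      ∑ t : Template k n, Real.exp (-(l * y)) * (templateWeight p i t *
        ∏ e, Real.exp (l * if t e = Finset.univ then w e else 0)) := by
    refine Finset.sum_le_sum fun t _ => ?_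
    have hW := weight_nonneg hp i t
    by_cases ht : t ∈ devSet (k := k) p ε w
    · rw [Set.indicator_of_mem ht]
      have h2 : Real.exp (-(l * y)) * (templateWeight p i t *
        ∏ e, Real.exp (l * if t e = Finset.univ then w e else 0)) =
        templateWeight p i t *
          Real.exp (l * ((∑ e, if t e = Finset.univ then w e else 0) - y)) := by
        rw [← Real.exp_sum, ← Finset.mul_sum, mul_left_comm, ← Real.exp_add]
        congr 2
        ring
      rw [h2]
      refine le_mul_of_one_le_right hW (Real.one_le_exp ?_)
      have : y < ∑ e, if t e = Finset.univ then w e else 0 := ht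
      exact mul_nonneg hl0.le (by linarith)
    · rw [Set.indicator_of_notMem ht]
      have : 0 ≤ ∏ e, Real.exp (l * if t e = Finset.univ then w e else 0) :=
        Finset.prod_nonneg fun _ _ => (Real.exp_pos _).le
      positivity
  refine h1.trans ?_
  rw [← Finset.mul_sum, weight_sum hk p i
    (fun e s => Real.exp (l * if s = Finset.univ then w e else 0))]
  have h3 : ∏ e : Edge n, (p * Real.exp (l * if (Finset.univ : Finset (Fin k)) = Finset.univ
      then w e else 0) + (1 - p) * Real.exp (l * if ({i} : Finset (Fin k)) = Finset.univ
      then w e else 0)) ≤ ∏ e : Edge n, Real.exp (p * (l * w e + l ^ 2)) := by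
    refine Finset.prod_le_prod (fun e _ => ?_) (fun e _ => ?_)
    · have : 0 ≤ 1 - p := by linarith [hp.2]
      have := hp.1
      positivity
    · rw [if_pos rfl, if_neg (univ_ne_single hk i).symm, mul_zero, Real.exp_zero, mul_one]
      have h4 : |l * w e| ≤ 1 := by
        rw [abs_mul, abs_of_pos hl0]
        exact mul_le_one₀ hl1 (abs_nonneg _) (hw e)
      have h5 := (abs_le.1 (Real.abs_exp_sub_one_sub_id_le h4)).2
      have h6 : (l * w e) ^ 2 ≤ l ^ 2 := by
        rw [mul_pow]
        refine mul_le_of_le_one_right (by positivity) ?_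
        rw [← sq_abs]
        exact pow_le_one₀ (abs_nonneg _) (hw e)
      have h7 : Real.exp (l * w e) ≤ 1 + (l * w e + l ^ 2) := by linarith
      have h8 := mul_le_mul_of_nonneg_left h7 hp.1.le
      have h9 := Real.add_one_le_exp (p * (l * w e + l ^ 2))
      linarith
  refine (mul_le_mul_of_nonneg_left h3 (Real.exp_pos _).le).trans ?_
  rw [← Real.exp_sum, ← Real.exp_add, Real.exp_le_exp, ← Finset.mul_sum, Finset.sum_add_distrib,
    ← Finset.mul_sum, Finset.sum_const, Finset.card_univ, nsmul_eq_mul, hy]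
  have h10 : (Fintype.card (Edge n) : ℝ) * l ^ 2 ≤ (n : ℝ) ^ 2 * l ^ 2 :=
    mul_le_mul_of_nonneg_right (card_edge_le n) (by positivity)
  have h11 := mul_le_mul_of_nonneg_left h10 hp.1.le
  have h12 : l ^ 2 ≤ l * (ε / 2) := by rw [sq]; exact mul_le_mul_of_nonneg_left hl2 hl0.le
  have h13 := mul_le_mul_of_nonneg_left h12 (by have := hp.1; positivity : 0 ≤ p * (n : ℝ) ^ 2)
  nlinarith

lemma mono_set {k n : ℕ} {i : Fin k} {P : ∀ n, Set (Colouring k n)} (hmono : IMonotone i P)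
    (D : Finset (Edge n)) (c : Colouring k n) (hc : c ∈ P n) :
    (fun e => if e ∈ D then i else c e) ∈ P n := by
  classical
  induction D using Finset.induction_on with
  | empty => simpa using hc
  | insert a D ha ih =>
    have := hmono n _ a ih
    convert this using 1
    ext e
    by_cases hea : e = a
    · subst hea; simp
    · simp [hea]

lemma lower_det {k n : ℕ} (hk : 2 ≤ k) {i : Fin k} {P : ∀ n, Set (Colouring k n)}
    (hmono : IMonotone i P) (t : Template k n) (ht : Proper t)
    (htP : ∀ c, Realises c t → c ∈ P n) (T : Template k n)
    (hT : ∀ e, T e = Finset.univ ∨ T e = {i}) :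
    (∑ e, if T e = Finset.univ then Real.logb k (t e).card else 0) ≤ exEntRel T (P n) := by
  classical
  refine le_csSup ⟨n.choose 2, ?_⟩
    ⟨fun e => if T e = Finset.univ then t e else {i}, ?_, ?_, ?_, ?_⟩
  · rintro x ⟨t, -, -, -, rfl⟩
    exact ent_le hk t
  · intro e
    simp only
    split_ifs
    · exact ht e
    · simp
  · intro e
    simp only
    split_ifs with h
    · rw [h]; exact Finset.subset_univ _
    · rw [(hT e).resolve_left h]
  · intro c hc
    choose d hd using ht
    have h0 : (fun e => if T e = Finset.univ then c e else d e) ∈ P n := by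
      refine htP _ fun e => ?_
      have := hc e
      simp only at this ⊢
      split_ifs with h
      · simpa [h] using this
      · exact hd e
    have h1 := mono_set hmono (Finset.univ.filter (fun e => T e ≠ Finset.univ)) _ h0
    convert h1 using 1
    ext e
    have := hc e
    by_cases h : T e = Finset.univ
    · simp [h]
    · simp only [h, if_false, Finset.mem_singleton] at this
      simp [h, this]
  · unfold Ent
    refine Finset.sum_congr rfl fun e _ => ?_
    by_cases h : T e = Finset.univ <;> simp [h]

lemma exEnt_attained {k n : ℕ} (A : Set (Colouring k n)) (hA : A.Nonempty) :
    ∃ t : Template k n, Proper t ∧ (∀ c, Realises c t → c ∈ A) ∧ Ent t = exEnt A := by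
  have hfin : {x : ℝ | ∃ t : Template k n, Proper t ∧ (∀ c, Realises c t → c ∈ A) ∧
      Ent t = x}.Finite := by
    refine (Set.finite_range (fun t : Template k n => Ent t)).subset ?_
    rintro x ⟨t, -, -, rfl⟩
    exact ⟨t, rfl⟩
  obtain ⟨c, hc⟩ := hA
  have hne : {x : ℝ | ∃ t : Template k n, Proper t ∧ (∀ c, Realises c t → c ∈ A) ∧
      Ent t = x}.Nonempty := by
    refine ⟨_, fun e => {c e}, fun e => by simp, fun d hd => ?_, rfl⟩
    have : d = c := by
      ext e
      have := hd e
      rw [Finset.mem_singleton] at this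
      rw [this]
    rw [this]; exact hc
  exact hne.csSup_mem hfin

lemma fixed_n {k N n : ℕ} (hk : 2 ≤ k) (i : Fin k)
    (F : Set (Colouring k N)) (P : ∀ n, Set (Colouring k n)) (hPdef : ∀ n, P n = Forb F n)
    (hmono : IMonotone i P) (hne : (P n).Nonempty) {p ε : ℝ} (hp : p ∈ Set.Ioc (0 : ℝ) 1)
    (hε : 0 < ε) (E : Finset (HIdx k N n)) (hE : ∀ x, x ∈ E → x.2 ∈ F)
    (𝒞 : Finset (Finset (Edge n × Fin k)))
    (h𝒞 : ∀ C ∈ 𝒞, Proper (tOf C) → Ent (tOf C) ≤ exEnt (Forb F n) + ε * (n : ℝ) ^ 2)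
    (hcov : ∀ I, (∀ x ∈ E, ¬ gset x ⊆ I) → ∃ C ∈ 𝒞, I ⊆ C) :
    1 - (𝒞.card + 1) * Real.exp (-(min 1 (ε / 2) * ε / 2) * (p * (n : ℝ) ^ 2)) ≤
      templateProb p i {T : Template k n |
          p * (exEnt (P n) - ε * (n : ℝ) ^ 2) ≤ exEntRel T (P n) ∧
          exEntRel T (P n) ≤ p * (exEnt (P n) + 2 * ε * (n : ℝ) ^ 2)} ∧
      templateProb p i {T : Template k n |
          p * (exEnt (P n) - ε * (n : ℝ) ^ 2) ≤ exEntRel T (P n) ∧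
          exEntRel T (P n) ≤ p * (exEnt (P n) + 2 * ε * (n : ℝ) ^ 2)} ≤ 1 := by
  classical
  set Good := {T : Template k n |
          p * (exEnt (P n) - ε * (n : ℝ) ^ 2) ≤ exEntRel T (P n) ∧
          exEntRel T (P n) ≤ p * (exEnt (P n) + 2 * ε * (n : ℝ) ^ 2)} with hGood
  set X := Real.exp (-(min 1 (ε / 2) * ε / 2) * (p * (n : ℝ) ^ 2)) with hX
  have htot := weight_total (n := n) hk p i
  constructor
  swap
  · rw [← htot]
    refine Finset.sum_le_sum fun t _ => ?_
    exact Set.indicator_le_self' (fun _ _ => weight_nonneg hp i _) t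
  obtain ⟨t₀, ht₀, ht₀P, ht₀E⟩ := exEnt_attained (P n) hne
  set wC : Finset (Edge n × Fin k) → Edge n → ℝ :=
    fun C e => Real.logb k (tOf C e).card with hwC
  set w0 : Edge n → ℝ := fun e => - Real.logb k (t₀ e).card with hw0
  have key : ∀ T : Template k n, T ∉ Good → templateWeight p i T ≠ 0 →
      T ∈ devSet (k := k) p ε w0 ∨ ∃ C ∈ 𝒞, T ∈ devSet (k := k) p ε (wC C) := by
    intro T hTG hTw
    have hT := weight_supp i T hTw
    by_contra hcon
    push Not at hcon
    obtain ⟨hc0, hcC⟩ := hcon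
    refine hTG ⟨?_, ?_⟩
    · refine le_trans ?_ (lower_det hk hmono t₀ ht₀ ht₀P T hT)
      have h1 := hc0
      simp only [devSet, Set.mem_setOf_eq, not_lt] at h1
      have h2 : (∑ e, if T e = Finset.univ then w0 e else 0) =
          - ∑ e, if T e = Finset.univ then Real.logb k (t₀ e).card else 0 := by
        rw [← Finset.sum_neg_distrib]
        refine Finset.sum_congr rfl fun e _ => ?_
        split_ifs <;> simp [hw0]
      have h3 : ∑ e, w0 e = - exEnt (P n) := by
        rw [← ht₀E]; unfold Ent; rw [← Finset.sum_neg_distrib]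
      rw [h2, h3] at h1
      linarith
    · have hex := exEnt_nonneg hk (P n)
      refine Real.sSup_le ?_ (mul_nonneg hp.1.le (by positivity))
      rintro _ ⟨t', ht', htT, htP, rfl⟩
      obtain ⟨C, hC, hIC⟩ := hcov (Finset.univ.filter (fun v => v.2 ∈ t' v.1)) (by
        intro x hx hsub
        choose d hd using ht'
        have hmem : ∀ e : Edge N, x.2 e ∈ t' (Edge.map x.1.1 x.1.2 e) := by
          intro e
          exact (Finset.mem_filter.1 (hsub ((mem_gset x (_, _)).2 ⟨e, rfl, rfl⟩))).2
        set c : Colouring k n := fun e' => if h : ∃ e, Edge.map x.1.1 x.1.2 e = e' then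
          x.2 h.choose else d e' with hc
        have hcP : c ∈ P n := by
          refine htP c fun e' => ?_
          simp only [hc]
          split_ifs with h
          · have := hmem h.choose
            rwa [h.choose_spec] at this
          · exact hd e'
        rw [hPdef] at hcP
        refine hcP x.1.1 x.1.2 ?_
        have : restrictC c x.1.1 x.1.2 = x.2 := by
          ext e
          have h : ∃ e', Edge.map x.1.1 x.1.2 e' = Edge.map x.1.1 x.1.2 e := ⟨e, rfl⟩
          have h2 : h.choose = e := edge_map_inj _ _ h.choose_spec
          simp only [restrictC, hc]
          rw [dif_pos h, h2]
        rw [this]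
        exact hE x hx)
      have hsub : ∀ e, t' e ⊆ tOf C e := by
        intro e c hc
        exact Finset.mem_filter.2 ⟨Finset.mem_univ _,
          hIC (Finset.mem_filter.2 ⟨Finset.mem_univ _, hc⟩)⟩
      have hprop : Proper (tOf C) := fun e => (ht' e).mono (hsub e)
      have h1 := h𝒞 C hC hprop
      have h2 := hcC C hC
      simp only [devSet, Set.mem_setOf_eq, not_lt] at h2
      have h3 : Ent t' ≤ ∑ e, if T e = Finset.univ then wC C e else 0 := by
        unfold Ent
        refine Finset.sum_le_sum fun e _ => ?_
        split_ifs with h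
        · exact logw_mono hk (Finset.card_pos.2 (ht' e)) (Finset.card_le_card (hsub e))
        · have h4 := htT e
          rw [(hT e).resolve_left h] at h4
          have h5 := Finset.card_le_card h4
          rw [Finset.card_singleton] at h5
          have h6 := Finset.card_pos.2 (ht' e)
          have h7 : (t' e).card = 1 := by omega
          simp [h7]
      have h4 : ∑ e, wC C e = Ent (tOf C) := rfl
      rw [h4] at h2
      rw [← hPdef] at h1
      have h5 := mul_le_mul_of_nonneg_left h1 hp.1.le
      linarith
  have hcomp : 1 - templateProb p i Good ≤
      templateProb p i (devSet (k := k) p ε w0) +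
        ∑ C ∈ 𝒞, templateProb p i (devSet (k := k) p ε (wC C)) := by
    rw [← htot]
    unfold templateProb
    rw [← Finset.sum_sub_distrib, Finset.sum_comm, ← Finset.sum_add_distrib]
    refine Finset.sum_le_sum fun T _ => ?_
    have hW := weight_nonneg hp i T
    have hnn : ∀ A : Set (Template k n), 0 ≤ A.indicator (templateWeight p i) T :=
      fun A => Set.indicator_nonneg (fun t _ => weight_nonneg hp i t) T
    have hsn : 0 ≤ ∑ C ∈ 𝒞, (devSet (k := k) p ε (wC C)).indicator (templateWeight p i) T :=
      Finset.sum_nonneg fun C _ => hnn _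
    by_cases hG : T ∈ Good
    · rw [Set.indicator_of_mem hG, sub_self]
      exact add_nonneg (hnn _) hsn
    · rw [Set.indicator_of_notMem hG, sub_zero]
      by_cases hz : templateWeight p i T = 0
      · rw [hz]; exact add_nonneg (hnn _) hsn
      rcases key T hG hz with h | ⟨C, hC, h⟩
      · rw [Set.indicator_of_mem h]; linarith
      · have h1 := Finset.single_le_sum
          (f := fun C => (devSet (k := k) p ε (wC C)).indicator (templateWeight p i) T)
          (fun C _ => hnn _) hC
        simp only [Set.indicator_of_mem h] at h1
        have := hnn (devSet (k := k) p ε w0)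
        linarith
  have habs : ∀ s : Finset (Fin k), |Real.logb k s.card| ≤ 1 := fun s => by
    rw [abs_of_nonneg (logw_nonneg hk _)]; exact logw_le_one hk s
  have b0 := dev_bound hk hp i hε w0 (fun e => by simp only [hw0, abs_neg]; exact habs _)
  have bC : ∑ C ∈ 𝒞, templateProb p i (devSet (k := k) p ε (wC C)) ≤ 𝒞.card * X := by
    rw [← nsmul_eq_mul, ← Finset.sum_const]
    exact Finset.sum_le_sum fun C _ => dev_bound hk hp i hε (wC C) (fun e => habs _)
  linarith

lemma ev_rpow (c s : ℝ) (hs : 0 < s) : ∀ᶠ n : ℕ in atTop, c ≤ (n : ℝ) ^ s :=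
  ((tendsto_rpow_atTop hs).comp tendsto_natCast_atTop_atTop).eventually_ge_atTop c

lemma ev_log (c s d : ℝ) (hs : 0 < s) (hd : 0 < d) :
    ∀ᶠ n : ℕ in atTop, c * Real.log n ≤ d * (n : ℝ) ^ s := by
  have h := ((isLittleO_log_rpow_atTop hs).comp_tendsto
    tendsto_natCast_atTop_atTop (k := fun n : ℕ => (n : ℝ))).bound
    (show 0 < d / (|c| + 1) by positivity)
  filter_upwards [h, eventually_ge_atTop 1] with n hn h1
  have hn1 : (1 : ℝ) ≤ n := by exact_mod_cast h1
  have hl : 0 ≤ Real.log n := Real.log_nonneg hn1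
  have hr : 0 ≤ (n : ℝ) ^ s := by positivity
  simp only [Function.comp, Real.norm_eq_abs, abs_of_nonneg hl, abs_of_nonneg hr] at hn
  rw [div_mul_eq_mul_div, le_div_iff₀ (by positivity)] at hn
  nlinarith [le_abs_self c]

lemma cond_one (r k : ℕ) (hr : 1 ≤ r) (hk : 2 ≤ k) (κ : ℝ) (hκ : 0 < κ) :
    ∀ᶠ n : ℕ in atTop, (r : ℝ) / n ≤
      κ * ((⌈(n : ℝ) ^ (2 - 2 / (4 * (r : ℝ) - 3))⌉₊ : ℝ) / (k * (n : ℝ) ^ 2)) ^ (r - 1) := by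
  have hr1 : (1 : ℝ) ≤ r := by exact_mod_cast hr
  set α := 2 / (4 * (r : ℝ) - 3) with hα
  have hs : 0 < 1 - α * ((r : ℝ) - 1) := by
    have : 1 - α * ((r : ℝ) - 1) = (2 * r - 1) / (4 * r - 3) := by
      rw [hα]; field_simp [show (4 * (r : ℝ) - 3) ≠ 0 by linarith]; ring
    rw [this]; exact div_pos (by linarith) (by linarith)
  have hk0 : (0 : ℝ) < k := by exact_mod_cast (by omega : 0 < k)
  filter_upwards [ev_rpow ((r : ℝ) * k ^ (r - 1) / κ) _ hs, eventually_ge_atTop 1] with n hn h1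
  have hn0 : (0 : ℝ) < n := by exact_mod_cast h1
  have hb : (n : ℝ) ^ (-α) / k ≤
      (⌈(n : ℝ) ^ (2 - α)⌉₊ : ℝ) / (k * (n : ℝ) ^ 2) := by
    rw [div_le_div_iff₀ hk0 (by positivity)]
    have h2 : (n : ℝ) ^ (2 - α) = (n : ℝ) ^ (-α) * (n : ℝ) ^ 2 := by
      rw [← Real.rpow_natCast (n : ℝ) 2, ← Real.rpow_add hn0]; congr 1; push_cast; ring
    have h3 := Nat.le_ceil ((n : ℝ) ^ (2 - α))
    rw [h2] at h3 ⊢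
    nlinarith
  have hb0 : 0 ≤ (n : ℝ) ^ (-α) / k := by positivity
  refine le_trans ?_ (mul_le_mul_of_nonneg_left (pow_le_pow_left₀ hb0 hb (r - 1)) hκ.le)
  have h4 : (n : ℝ) ^ (1 - α * ((r : ℝ) - 1)) = n * ((n : ℝ) ^ (-α)) ^ (r - 1) := by
    rw [← Real.rpow_natCast, ← Real.rpow_mul hn0.le, Nat.cast_sub hr]
    nth_rewrite 2 [← Real.rpow_one (n : ℝ)]
    rw [← Real.rpow_add hn0]; congr 1; push_cast; ring
  rw [h4, div_le_iff₀ hκ] at hn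
  rw [div_pow, div_le_iff₀ hn0, mul_div_assoc', div_mul_eq_mul_div, le_div_iff₀ (by positivity)]
  linarith

lemma ceil_le_two (n : ℕ) (s : ℝ) (hs : 0 ≤ s) (h1 : 1 ≤ n) :
    (⌈(n : ℝ) ^ s⌉₊ : ℝ) ≤ 2 * (n : ℝ) ^ s := by
  have hn1 : (1 : ℝ) ≤ n := by exact_mod_cast h1
  have := Nat.ceil_lt_add_one (show 0 ≤ (n : ℝ) ^ s by positivity)
  have := Real.one_le_rpow hn1 hs
  linarith

lemma cond_two (r k : ℕ) (hr : 1 ≤ r) (hk : 2 ≤ k) (γ : ℝ) (hγ : 0 < γ) :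
    ∀ᶠ n : ℕ in atTop,
      (⌈(n : ℝ) ^ (2 - 2 / (4 * (r : ℝ) - 3))⌉₊ : ℝ) ≤ γ * (k * (n : ℝ) ^ 2) := by
  have hr1 : (1 : ℝ) ≤ r := by exact_mod_cast hr
  set α := 2 / (4 * (r : ℝ) - 3) with hα
  have hα0 : 0 < α := div_pos two_pos (by linarith)
  have hα2 : α ≤ 2 := by rw [hα, div_le_iff₀ (by linarith)]; linarith
  have hk0 : (0 : ℝ) < k := by exact_mod_cast (by omega : 0 < k)
  filter_upwards [ev_rpow (2 / (γ * k)) _ hα0, eventually_ge_atTop 1] with n hn h1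
  have hn0 : (0 : ℝ) < n := by exact_mod_cast h1
  refine (ceil_le_two n _ (by linarith) h1).trans ?_
  have h2 : (n : ℝ) ^ 2 = (n : ℝ) ^ (2 - α) * (n : ℝ) ^ α := by
    rw [← Real.rpow_natCast (n : ℝ) 2, ← Real.rpow_add hn0]; congr 1; push_cast; ring
  rw [h2]
  rw [div_le_iff₀ (by positivity)] at hn
  have h3 : 0 ≤ (n : ℝ) ^ (2 - α) := by positivity
  nlinarith [mul_le_mul_of_nonneg_left hn h3]

lemma cond_three (r k J : ℕ) (hr : 1 ≤ r) (hk : 2 ≤ k) (ζ : ℝ) (hζ : 0 < ζ) (p : ℕ → ℝ)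
    (hpg : Tendsto (fun n => p n * (n : ℝ) ^ (1 / (2 * (r : ℝ) - 1))) atTop atTop) :
    ∀ᶠ n : ℕ in atTop,
      ((((k * n ^ 2 + 1) ^ (⌈(n : ℝ) ^ (2 - 2 / (4 * (r : ℝ) - 3))⌉₊ * (r - 1))) ^ J : ℕ) : ℝ) ≤
        Real.exp (ζ / 2 * (p n * (n : ℝ) ^ 2)) := by
  have hr1 : (1 : ℝ) ≤ r := by exact_mod_cast hr
  set α := 2 / (4 * (r : ℝ) - 3) with hα
  set x := 1 / (2 * (r : ℝ) - 1) with hx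
  have hα2 : α ≤ 2 := by rw [hα, div_le_iff₀ (by linarith)]; linarith
  have hax : 0 < α - x := by
    have : x < α := by
      rw [hα, hx, div_lt_div_iff₀ (by linarith) (by linarith)]; linarith
    linarith
  filter_upwards [ev_log (6 * ((r - 1 : ℕ) * J)) _ (ζ / 2) hax (by positivity),
    eventually_ge_atTop (k + 1), hpg.eventually_ge_atTop 1] with n hn h1 hp1
  have hn0 : (0 : ℝ) < n := by exact_mod_cast (by omega : 0 < n)
  have hn1 : (1 : ℝ) ≤ n := by exact_mod_cast (by omega : 1 ≤ n)
  have hlog0 : 0 ≤ Real.log n := Real.log_nonneg hn1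
  set a := ⌈(n : ℝ) ^ (2 - α)⌉₊ with ha
  have ha2 : (a : ℝ) ≤ 2 * (n : ℝ) ^ (2 - α) := ceil_le_two n _ (by linarith) (by omega)
  have hle : ((k * n ^ 2 + 1 : ℕ) : ℝ) ≤ Real.exp (3 * Real.log n) := by
    have h2 : Real.exp (3 * Real.log n) = (n : ℝ) ^ 3 := by
      rw [mul_comm, Real.exp_mul, Real.exp_log hn0]; exact_mod_cast rfl
    rw [h2]
    have : k * n ^ 2 + 1 ≤ n ^ 3 := by
      have : (k + 1) * n ^ 2 ≤ n * n ^ 2 := Nat.mul_le_mul_right _ h1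
      have h4 : 1 ≤ n ^ 2 := Nat.one_le_pow _ _ (by omega)
      nlinarith
    exact_mod_cast this
  have h5 : ((((k * n ^ 2 + 1) ^ (a * (r - 1))) ^ J : ℕ) : ℝ) ≤
      Real.exp (3 * Real.log n) ^ (a * (r - 1) * J) := by
    rw [← pow_mul, Nat.cast_pow]
    exact pow_le_pow_left₀ (by positivity) hle _
  refine h5.trans ?_
  rw [← Real.exp_nat_mul, Real.exp_le_exp]
  have h6 : (n : ℝ) ^ (2 - α) * (n : ℝ) ^ (α - x) ≤ p n * (n : ℝ) ^ 2 := by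
    have h7 : (n : ℝ) ^ 2 = (n : ℝ) ^ x * (n : ℝ) ^ (2 - x) := by
      rw [← Real.rpow_natCast (n : ℝ) 2, ← Real.rpow_add hn0]; congr 1; push_cast; ring
    have h8 : (n : ℝ) ^ (2 - α) * (n : ℝ) ^ (α - x) = (n : ℝ) ^ (2 - x) := by
      rw [← Real.rpow_add hn0]; congr 1; ring
    rw [h7, h8, ← mul_assoc]
    exact le_mul_of_one_le_left (by positivity) hp1
  have h9 : ((a * (r - 1) * J : ℕ) : ℝ) * (3 * Real.log n) ≤
      (n : ℝ) ^ (2 - α) * (6 * ((r - 1 : ℕ) * J) * Real.log n) := by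
    have h10 : (0 : ℝ) ≤ ((r - 1 : ℕ) : ℝ) * J * (3 * Real.log n) := by positivity
    have := mul_le_mul_of_nonneg_right ha2 h10
    rw [Nat.cast_mul, Nat.cast_mul]
    nlinarith
  refine h9.trans ?_
  refine (mul_le_mul_of_nonneg_left hn (by positivity)).trans ?_
  nlinarith

/-- Transference (Theorem 2.24). -/
theorem transference (k N : ℕ) (hk : 2 ≤ k) (hN : 2 ≤ N) (i : Fin k)
    (F : Set (Colouring k N)) (hF : F.Nonempty)
    (P : ∀ n, Set (Colouring k n)) (hPdef : ∀ n, P n = Forb F n)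
    (hher : OrderHereditary P) (hmono : IMonotone i P) (hne : ∀ n, (P n).Nonempty)
    (p : ℕ → ℝ) (hp : ∀ n, p n ∈ Set.Ioc (0 : ℝ) 1)
    (hpg : Tendsto (fun n => p n * (n : ℝ) ^ (1 / (2 * (N.choose 2 : ℝ) - 1))) atTop atTop)
    (ε : ℝ) (hε : 0 < ε) :
    Tendsto (fun n => templateProb (p n) i
        {T : Template k n |
          p n * (exEnt (P n) - ε * (n : ℝ) ^ 2) ≤ exEntRel T (P n) ∧
          exEntRel T (P n) ≤ p n * (exEnt (P n) + 2 * ε * (n : ℝ) ^ 2)})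
      atTop (nhds 1) := by
  classical
  set r := N.choose 2 with hrdef
  have hr : 1 ≤ r := Nat.choose_pos hN
  have hr1 : (1 : ℝ) ≤ r := by exact_mod_cast hr
  set ζ := min 1 (ε / 2) * ε / 2 with hζdef
  have hζ : 0 < ζ := by positivity
  obtain ⟨δ₀, hδ₀, n₀, hsup⟩ := supersat k N hk hN F ε hε
  obtain ⟨J, γ, hγ, κ, hκ, hcont⟩ := container_family k N (by omega) hN δ₀ hδ₀
  have hpn : Tendsto (fun n : ℕ => p n * (n : ℝ) ^ 2) atTop atTop := by
    refine tendsto_atTop_mono' _ ?_ hpg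
    filter_upwards [eventually_ge_atTop 1] with n h1
    have hn1 : (1 : ℝ) ≤ n := by exact_mod_cast h1
    refine mul_le_mul_of_nonneg_left ?_ (hp n).1.le
    rw [← Real.rpow_natCast (n : ℝ) 2]
    refine Real.rpow_le_rpow_of_exponent_le hn1 ?_
    rw [div_le_iff₀ (by linarith)]
    push_cast
    linarith
  have hlim : Tendsto (fun n : ℕ => 1 - 2 * Real.exp (-(ζ / 2 * (p n * (n : ℝ) ^ 2))))
      atTop (nhds 1) := by
    have h1 := Real.tendsto_exp_neg_atTop_nhds_zero.comp
      (hpn.const_mul_atTop (half_pos hζ))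
    have h2 := (h1.const_mul 2).const_sub 1
    simpa using h2
  have hev : ∀ᶠ n : ℕ in atTop,
      1 - 2 * Real.exp (-(ζ / 2 * (p n * (n : ℝ) ^ 2))) ≤ templateProb (p n) i
        {T : Template k n |
          p n * (exEnt (P n) - ε * (n : ℝ) ^ 2) ≤ exEntRel T (P n) ∧
          exEntRel T (P n) ≤ p n * (exEnt (P n) + 2 * ε * (n : ℝ) ^ 2)} ∧
      templateProb (p n) i
        {T : Template k n |
          p n * (exEnt (P n) - ε * (n : ℝ) ^ 2) ≤ exEntRel T (P n) ∧
          exEntRel T (P n) ≤ p n * (exEnt (P n) + 2 * ε * (n : ℝ) ^ 2)} ≤ 1 := by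
    filter_upwards [cond_one r k hr hk κ hκ, cond_two r k hr hk γ hγ,
      cond_three r k J hr hk ζ hζ p hpg, eventually_ge_atTop n₀, eventually_ge_atTop 1]
      with n c1 c2 c3 hn0 hn1
    have hn0' : (0 : ℝ) < n := by exact_mod_cast hn1
    set E : Finset (HIdx k N n) := Finset.univ.filter (fun x => x.2 ∈ F) with hE
    have hEmem : ∀ x, x ∈ E ↔ x.2 ∈ F := fun x => by simp [hE]
    obtain ⟨𝒞, hcard, hfew, hcov⟩ := hcont n _ E hn1
      (Nat.one_le_ceil_iff.2 (by positivity)) c1 c2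
    have hfix := fixed_n hk i F P hPdef hmono (hne n) (hp n) hε E
      (fun x hx => (hEmem x).1 hx) 𝒞
      (fun C hC hC2 => hsup n hn0 E (fun x hx => (hEmem x).2 hx) C hC2 (hfew C hC)) hcov
    refine ⟨le_trans ?_ hfix.1, hfix.2⟩
    have hc : (𝒞.card : ℝ) ≤ Real.exp (ζ / 2 * (p n * (n : ℝ) ^ 2)) :=
      le_trans (by exact_mod_cast hcard) c3
    set y := ζ / 2 * (p n * (n : ℝ) ^ 2) with hy
    have hy0 : 0 ≤ y := by have := (hp n).1; positivity
    have e1 : Real.exp (-(min 1 (ε / 2) * ε / 2) * (p n * (n : ℝ) ^ 2)) =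
        Real.exp (-y) * Real.exp (-y) := by
      rw [← Real.exp_add]; congr 1; rw [hy, hζdef]; ring
    rw [e1]
    have e2 : Real.exp y * Real.exp (-y) = 1 := by rw [← Real.exp_add]; simp
    have e3 : Real.exp (-y) ≤ 1 := Real.exp_le_one_iff.2 (by linarith)
    have e4 := Real.exp_pos (-y)
    have e5 : ((𝒞.card : ℝ) + 1) * Real.exp (-y) ≤ 2 := by
      have := mul_le_mul_of_nonneg_right hc e4.le
      rw [e2] at this
      linarith
    have := mul_le_mul_of_nonneg_right e5 e4.le
    linarith
  exact tendsto_of_tendsto_of_tendsto_of_le_of_le' hlim tendsto_const_nhds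
    (hev.mono fun _ h => h.1) (hev.mono fun _ h => h.2)
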